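/- arXiv:1403.2634 — 4 statements merged into one kernel-verified Lean document; each statement's English description precedes it below -/
import Mathlib

section
/- Let Γ be a subgroup of Homeo₊(I) whose height h(Γ) equals a finite number N. Then Γ is solvable of solvability degree at most N. -/
open Set

namespace HeightHomeo

/-- The group of orientation-preserving homeomorphisms of a linearly ordered space,
modeled as order-automorphisms (for `I = [0,1]` these are exactly the
orientation-preserving homeomorphisms). -/
instance ordIsoGroup {α : Type*} [Preorder α] : Group (α ≃o α) where
  mul f g := g.trans f
  one := OrderIso.refl α
  inv := OrderIso.symm
  mul_assoc _ _ _ := rfl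
  one_mul _ := rfl
  mul_one _ := rfl
  inv_mul_cancel f := by ext x; exact f.symm_apply_apply x

/-- `Homeo₊(I)`: the group of orientation-preserving homeomorphisms of the closed
unit interval `I = [0,1]`. -/
abbrev HomeoI := unitInterval ≃o unitInterval

/-- The order-convex hull of a set of points of the unit interval. -/
def ordHull (S : Set unitInterval) : Set unitInterval :=
  {y | ∃ a ∈ S, ∃ b ∈ S, a ≤ y ∧ y ≤ b}

/-- `A` is an orbital of the homeomorphism `g`: the convex hull of the orbit of some
point of `I` under the cyclic subgroup `⟨g⟩`, provided it contains more than one point. -/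
def IsOrbitalOf (g : HomeoI) (A : Set unitInterval) : Prop :=
  ∃ x : unitInterval,
    A = ordHull (Set.range fun n : ℤ => (g ^ n) x) ∧ A.Nontrivial

/-- A tower of a subgroup `Γ ≤ Homeo₊(I)`: a set `T` of signed orbitals `(A, g)`
(with `g ∈ Γ` and `A` an orbital of `g`) whose orbitals form a chain under inclusion,
and containing exactly one signed orbital for each of the occurring orbitals. -/
def IsTower (Γ : Subgroup HomeoI) (T : Set (Set unitInterval × HomeoI)) : Prop :=
  (∀ p ∈ T, p.2 ∈ Γ ∧ IsOrbitalOf p.2 p.1) ∧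
  (∀ p ∈ T, ∀ q ∈ T, p.1 ⊆ q.1 ∨ q.1 ⊆ p.1) ∧
  (∀ p ∈ T, ∀ q ∈ T, p.1 = q.1 → p = q)

/-- The left endpoint of a set of points of the unit interval, as a real number. -/
noncomputable def leftEnd (A : Set unitInterval) : ℝ :=
  sInf ((fun x : unitInterval => (x : ℝ)) '' A)

/-- The right endpoint of a set of points of the unit interval, as a real number. -/
noncomputable def rightEnd (A : Set unitInterval) : ℝ :=
  sSup ((fun x : unitInterval => (x : ℝ)) '' A)

/-- Two intervals share an end if they have a common left endpoint or a common right
endpoint. -/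
def ShareEnd (A B : Set unitInterval) : Prop :=
  leftEnd A = leftEnd B ∨ rightEnd A = rightEnd B

/-- A tower is strict if no two distinct orbitals occurring in it share an end. -/
def IsStrictTower (Γ : Subgroup HomeoI) (T : Set (Set unitInterval × HomeoI)) : Prop :=
  IsTower Γ T ∧ ∀ p ∈ T, ∀ q ∈ T, p.1 ≠ q.1 → ¬ ShareEnd p.1 q.1

/-- The set of orbitals occurring in a tower. -/
def towerOrbitals (T : Set (Set unitInterval × HomeoI)) : Set (Set unitInterval) :=
  Prod.fst '' T

/-- The height `h(Γ)` of a subgroup of `Homeo₊(I)`: the supremum (in `ℕ∞`) of the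
cardinalities of the sets of orbitals of its towers. -/
noncomputable def height (Γ : Subgroup HomeoI) : ℕ∞ :=
  ⨆ T ∈ {T | IsTower Γ T}, (towerOrbitals T).encard

/-- The strict height `h_strict(Γ)` of a subgroup of `Homeo₊(I)`: the supremum (in
`ℕ∞`) of the cardinalities of the sets of orbitals of its strict towers. -/
noncomputable def strictHeight (Γ : Subgroup HomeoI) : ℕ∞ :=
  ⨆ T ∈ {T | IsStrictTower Γ T}, (towerOrbitals T).encard

section WeakOrder

open scoped commutatorElement

variable {G : Type*} [Group G]

/-- A bi-invariant Archimedean strict weak order on a group. -/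
structure IsArchimedeanWeakOrder (lt : G → G → Prop) : Prop where
  irrefl : ∀ a, ¬ lt a a
  trans : ∀ {a b c}, lt a b → lt b c → lt a c
  cotrans : ∀ {a c} b, lt a c → lt a b ∨ lt b c
  mul_left : ∀ {a b} c, lt a b → lt (c * a) (c * b)
  mul_right : ∀ {a b} c, lt a b → lt (a * c) (b * c)
  archimedean : ∀ {p}, lt 1 p → ∀ g, ∃ n : ℕ, ¬ lt (p ^ n) g

namespace IsArchimedeanWeakOrder

variable {lt : G → G → Prop} (h : IsArchimedeanWeakOrder lt)
include h

theorem not_lt_mul {a a' b b' : G} (h₁ : ¬ lt b a) (h₂ : ¬ lt b' a') :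
    ¬ lt (b * b') (a * a') := fun H => by
  rcases h.cotrans (b * a') H with H | H
  · exact h₂ (by simpa [mul_assoc] using h.mul_left b⁻¹ H)
  · exact h₁ (by simpa [mul_assoc] using h.mul_right a'⁻¹ H)

theorem one_lt_pow {p : G} (hp : lt 1 p) (k : ℕ) : lt 1 (p ^ (k + 1)) := by
  induction k with
  | zero => simpa using hp
  | succ k ih => exact h.trans hp (by simpa [pow_succ] using h.mul_right p ih)

theorem zpow_lt_zpow {p : G} (hp : lt 1 p) {m n : ℤ} (hmn : m < n) : lt (p ^ m) (p ^ n) := by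
  obtain ⟨k, rfl⟩ : ∃ k : ℕ, n = m + (k + 1 : ℕ) := ⟨(n - m - 1).toNat, by omega⟩
  rw [zpow_add, zpow_natCast]
  simpa only [mul_one] using h.mul_left (p ^ m) (h.one_lt_pow hp k)

theorem exists_zpow_near {p : G} (hp : lt 1 p) (f : G) :
    ∃ m : ℤ, ¬ lt f (p ^ m) ∧ lt f (p ^ (m + 1)) := by
  obtain ⟨n, hn⟩ := h.archimedean hp f
  obtain ⟨k, hk⟩ := h.archimedean hp f⁻¹
  obtain ⟨m, hm, hmax⟩ := Int.exists_greatest_of_bdd (P := fun m : ℤ => ¬ lt f (p ^ m))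
    ⟨n, fun z hz => by
      by_contra! hlt
      rcases h.cotrans f (h.zpow_lt_zpow hp hlt) with H | H
      · exact hn (by simpa using H)
      · exact hz H⟩
    ⟨-k, fun H => hk (by simpa [mul_assoc] using h.mul_right f⁻¹ (h.mul_left (p ^ k) H))⟩
  refine ⟨m, hm, ?_⟩
  by_contra H
  have := hmax _ H
  omega

/-- Hölder's theorem for weak orders: no commutator is positive. -/
theorem not_one_lt_commutatorElement (f g : G) : ¬ lt 1 ⁅f, g⁆ := by
  intro hc
  set c := ⁅f, g⁆ with hcdef
  have hcgf : c * (g * f) = f * g := by rw [hcdef, commutatorElement_def]; group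
  have hlt : lt (g * f) (f * g) := by
    rw [← hcgf]
    simpa only [one_mul] using h.mul_right (g * f) hc
  by_cases hd : ∃ d, lt 1 d ∧ ¬ lt c (d * d)
  · obtain ⟨d, hd, hdc⟩ := hd
    obtain ⟨m, hm, hm'⟩ := h.exists_zpow_near hd f
    obtain ⟨n, hn, hn'⟩ := h.exists_zpow_near hd g
    have h₁ : ¬ lt (f * g) (d * d * (d ^ n * d ^ m)) := by
      rw [← hcgf]
      exact h.not_lt_mul hdc (h.not_lt_mul hn hm)
    have h₂ : lt (f * g) (d ^ (m + 1) * d ^ (n + 1)) :=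
      h.trans (h.mul_right g hm') (h.mul_left _ hn')
    have h₃ : d ^ (m + 1) * d ^ (n + 1) = d * d * (d ^ n * d ^ m) := by group
    exact h₁ (h₃ ▸ h₂)
  · push Not at hd
    have key : ∀ (x : G) (m : ℤ), lt x (c ^ (m + 1)) → ¬ lt (c ^ m) x := by
      intro x m h₁ h₂
      have he : lt 1 ((c ^ m)⁻¹ * x) := by simpa using h.mul_left (c ^ m)⁻¹ h₂
      have hec : lt ((c ^ m)⁻¹ * x) c := by
        simpa [zpow_add] using h.mul_left (c ^ m)⁻¹ h₁
      generalize (c ^ m)⁻¹ * x = e at he hec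
      have hd₁ : lt 1 (e⁻¹ * c) := by simpa using h.mul_left e⁻¹ hec
      have hd₂ : lt (e⁻¹ * c) e := by simpa using h.mul_left e⁻¹ (hd e he)
      have := h.trans (hd _ hd₁) (h.mul_right (e⁻¹ * c) hd₂)
      rw [mul_inv_cancel_left] at this
      exact h.irrefl _ this
    obtain ⟨m, hm, hm'⟩ := h.exists_zpow_near hc f
    obtain ⟨n, hn, hn'⟩ := h.exists_zpow_near hc g
    have h₁ := h.not_lt_mul (key f m hm') (key g n hn')
    have h₂ := h.not_lt_mul hn hm
    rw [← zpow_add, add_comm] at h₂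
    rw [← zpow_add] at h₁
    exact (h.cotrans _ hlt).elim h₂ h₁

theorem not_lt_of_mem_commutator {x : G} (hx : x ∈ commutator G) :
    ¬ lt 1 x ∧ ¬ lt x 1 := by
  let K : Subgroup G :=
    { carrier := {x | ¬ lt 1 x ∧ ¬ lt x 1}
      one_mem' := ⟨h.irrefl 1, h.irrefl 1⟩
      mul_mem' := fun ha hb => ⟨by simpa using h.not_lt_mul ha.1 hb.1,
        by simpa using h.not_lt_mul ha.2 hb.2⟩
      inv_mem' := fun {a} ha => ⟨fun H => ha.2 (by simpa using h.mul_right a H),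
        fun H => ha.1 (by simpa using h.mul_right a H)⟩ }
  have hK : commutator G ≤ K := Subgroup.commutator_le.2 fun f _ g _ =>
    ⟨h.not_one_lt_commutatorElement f g, fun H => h.not_one_lt_commutatorElement g f <| by
      rw [← commutatorElement_inv]
      simpa only [inv_mul_cancel, mul_one] using h.mul_left ⁅f, g⁆⁻¹ H⟩
  exact hK hx

end IsArchimedeanWeakOrder

end WeakOrder

section Homeo

theorem mul_apply (f g : HomeoI) (x : unitInterval) : (f * g) x = f (g x) := rfl

theorem inv_apply_self (f : HomeoI) (x : unitInterval) : f⁻¹ (f x) = x := f.symm_apply_apply x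

theorem apply_inv_self (f : HomeoI) (x : unitInterval) : f (f⁻¹ x) = x := f.apply_symm_apply x

theorem inv_apply_le_iff {f : HomeoI} {x y : unitInterval} : f⁻¹ x ≤ y ↔ x ≤ f y := by
  rw [← f.le_iff_le, apply_inv_self]

theorem le_inv_apply_iff {f : HomeoI} {x y : unitInterval} : x ≤ f⁻¹ y ↔ f x ≤ y := by
  rw [← f.le_iff_le, apply_inv_self]

theorem inv_apply_lt_iff {f : HomeoI} {x y : unitInterval} : f⁻¹ x < y ↔ x < f y := by
  rw [← f.lt_iff_lt, apply_inv_self]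

theorem lt_inv_apply_iff {f : HomeoI} {x y : unitInterval} : x < f⁻¹ y ↔ f x < y := by
  rw [← f.lt_iff_lt, apply_inv_self]

theorem inv_apply_eq_of_apply_eq {f : HomeoI} {x : unitInterval} (h : f x = x) : f⁻¹ x = x := by
  conv_lhs => rw [← h]
  exact inv_apply_self f x

theorem pow_succ_apply (f : HomeoI) (n : ℕ) (x : unitInterval) :
    (f ^ (n + 1)) x = f ((f ^ n) x) := by
  rw [pow_succ', mul_apply]

theorem pow_apply_le {f : HomeoI} {x : unitInterval} (h : f x ≤ x) (n : ℕ) : (f ^ n) x ≤ x := by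
  induction n with
  | zero => exact le_rfl
  | succ n ih => exact (pow_succ_apply f n x).trans_le ((f.monotone ih).trans h)

theorem le_pow_apply {f : HomeoI} {x : unitInterval} (h : x ≤ f x) (n : ℕ) : x ≤ (f ^ n) x := by
  induction n with
  | zero => exact le_rfl
  | succ n ih => exact (h.trans (f.monotone ih)).trans_eq (pow_succ_apply f n x).symm

theorem pow_succ_apply_lt {f : HomeoI} {x : unitInterval} (h : f x < x) (n : ℕ) :
    (f ^ (n + 1)) x < x := by
  rw [pow_succ_apply]
  exact (f.monotone (pow_apply_le h.le n)).trans_lt h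

theorem pow_apply_eq_of_apply_eq {f : HomeoI} {x : unitInterval} (h : f x = x) (n : ℕ) :
    (f ^ n) x = x :=
  le_antisymm (pow_apply_le h.le n) (le_pow_apply h.ge n)

theorem zpow_apply_eq_of_apply_eq {f : HomeoI} {x : unitInterval} (h : f x = x) (n : ℤ) :
    (f ^ n) x = x := by
  obtain ⟨m, rfl | rfl⟩ := n.eq_nat_or_neg
  · rw [zpow_natCast, pow_apply_eq_of_apply_eq h]
  · rw [zpow_neg, zpow_natCast]
    exact inv_apply_eq_of_apply_eq (pow_apply_eq_of_apply_eq h m)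

/-- Intermediate value theorem for displacements. -/
theorem exists_apply_eq_of_le_of_le {f : HomeoI} {s : Set unitInterval} [s.OrdConnected]
    {x y : unitInterval} (hx : x ∈ s) (hy : y ∈ s) (hfx : x ≤ f x) (hfy : f y ≤ y) :
    ∃ z ∈ s, f z = z :=
  (OrdConnected.isPreconnected ‹_›).intermediate_value₂ hy hx
    f.continuous.continuousOn continuousOn_id hfy hfx

/-- `(a, b)` is a connected component of the complement of the fixed point set of `g`. -/
structure IsBump (g : HomeoI) (a b : unitInterval) : Prop where
  lt : a < b
  left : g a = a
  right : g b = b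
  apply_ne : ∀ x ∈ Ioo a b, g x ≠ x

theorem exists_isBump {g : HomeoI} {x : unitInterval} (hx : g x ≠ x) :
    ∃ a b, IsBump g a b ∧ x ∈ Ioo a b := by
  have hcl : IsClosed {z | g z = z} := isClosed_eq g.continuous continuous_id
  have hl : IsCompact (Iic x ∩ {z | g z = z}) := (isClosed_Iic.inter hcl).isCompact
  have hr : IsCompact (Ici x ∩ {z | g z = z}) := (isClosed_Ici.inter hcl).isCompact
  obtain ⟨a, ⟨hax, ha⟩, hamax⟩ := hl.exists_isGreatest ⟨0, x.2.1, g.map_bot⟩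
  obtain ⟨b, ⟨hbx, hb⟩, hbmin⟩ := hr.exists_isLeast ⟨1, x.2.2, g.map_top⟩
  have hax' : a < x := lt_of_le_of_ne hax (by rintro rfl; exact hx ha)
  have hbx' : x < b := lt_of_le_of_ne hbx (by rintro rfl; exact hx hb)
  refine ⟨a, b, ⟨hax'.trans hbx', ha, hb, fun z hz hgz => ?_⟩, hax', hbx'⟩
  rcases le_total z x with h | h
  · exact hz.1.not_ge (hamax ⟨h, hgz⟩)
  · exact hz.2.not_ge (hbmin ⟨h, hgz⟩)

namespace IsBump

variable {g : HomeoI} {a b : unitInterval}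

theorem inv (h : IsBump g a b) : IsBump g⁻¹ a b where
  lt := h.lt
  left := inv_apply_eq_of_apply_eq h.left
  right := inv_apply_eq_of_apply_eq h.right
  apply_ne x hx H := h.apply_ne x hx (by conv_lhs => rw [← H, apply_inv_self])

theorem conj (h : IsBump g a b) (k : HomeoI) : IsBump (k * g * k⁻¹) (k a) (k b) where
  lt := k.strictMono h.lt
  left := by rw [mul_apply, mul_apply, inv_apply_self, h.left]
  right := by rw [mul_apply, mul_apply, inv_apply_self, h.right]
  apply_ne x hx H := by
    refine h.apply_ne (k⁻¹ x) ⟨lt_inv_apply_iff.2 hx.1, inv_apply_lt_iff.2 hx.2⟩ ?_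
    apply k.injective
    rwa [apply_inv_self]

theorem apply_lt (h : IsBump g a b) {x y : unitInterval} (hx : x ∈ Ioo a b) (hgx : g x < x)
    (hy : y ∈ Ioo a b) : g y < y := by
  by_contra! H
  obtain ⟨z, hz, hgz⟩ := exists_apply_eq_of_le_of_le hy hx H hgx.le
  exact h.apply_ne z hz hgz

theorem forall_lt_or_forall_lt (h : IsBump g a b) :
    (∀ x ∈ Ioo a b, x < g x) ∨ ∀ x ∈ Ioo a b, x < g⁻¹ x := by
  by_cases H : ∀ x ∈ Ioo a b, x < g x
  · exact .inl H
  · push Not at H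
    obtain ⟨x, hx, hgx⟩ := H
    exact .inr fun y hy => lt_inv_apply_iff.2 <|
      h.apply_lt hx (hgx.lt_of_ne (h.apply_ne x hx)) hy

theorem apply_mem_Ioo_iff (ha : g a = a) (hb : g b = b) {x : unitInterval} :
    g x ∈ Ioo a b ↔ x ∈ Ioo a b := by
  conv_lhs => rw [← ha, ← hb]
  simp [mem_Ioo]

theorem exists_zpow_le (h : IsBump g a b) {x y : unitInterval} (hx : x ∈ Ioo a b)
    (hy : y ∈ Ioo a b) : ∃ n : ℤ, (g ^ n) x ≤ y := by
  by_contra! H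
  set m := ⨅ n : ℤ, (g ^ n) x with hm
  have hgm : g m = m := by
    rw [hm, OrderIso.map_iInf]
    exact (Equiv.addLeft (1 : ℤ)).iInf_congr fun n => by
      rw [Equiv.coe_addLeft, zpow_add, zpow_one, mul_apply]
  refine h.apply_ne m ⟨hy.1.trans_le (le_iInf fun n => (H n).le), ?_⟩ hgm
  exact (iInf_le (fun n : ℤ => (g ^ n) x) 0).trans_lt hx.2

theorem ordHull_eq (h : IsBump g a b) {x : unitInterval} (hx : x ∈ Ioo a b) :
    ordHull (range fun n : ℤ => (g ^ n) x) = Ioo a b := by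
  have key (n : ℤ) : (g ^ n) x ∈ Ioo a b :=
    (apply_mem_Ioo_iff (zpow_apply_eq_of_apply_eq h.left n)
      (zpow_apply_eq_of_apply_eq h.right n)).2 hx
  ext y
  constructor
  · rintro ⟨_, ⟨m, rfl⟩, _, ⟨n, rfl⟩, hm, hn⟩
    exact ⟨(key m).1.trans_le hm, hn.trans_lt (key n).2⟩
  · intro hy
    obtain ⟨m, hm⟩ := h.exists_zpow_le hx hy
    obtain ⟨n, hn⟩ := h.exists_zpow_le hy hx
    refine ⟨_, ⟨m, rfl⟩, _, ⟨-n, rfl⟩, hm, ?_⟩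
    simp only [zpow_neg]
    exact le_inv_apply_iff.2 hn

end IsBump

theorem isOrbitalOf_iff {g : HomeoI} {A : Set unitInterval} :
    IsOrbitalOf g A ↔ ∃ a b, IsBump g a b ∧ A = Ioo a b := by
  constructor
  · rintro ⟨x, rfl, hA⟩
    have hx : g x ≠ x := by
      intro hx
      refine hA.not_subsingleton ?_
      rintro y ⟨_, ⟨m, rfl⟩, _, ⟨n, rfl⟩, hm, hn⟩ z ⟨_, ⟨m', rfl⟩, _, ⟨n', rfl⟩, hm', hn'⟩
      simp only [zpow_apply_eq_of_apply_eq hx] at hm hn hm' hn'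
      exact (le_antisymm hn hm).trans (le_antisymm hm' hn')
    obtain ⟨a, b, h, hxab⟩ := exists_isBump hx
    exact ⟨a, b, h, h.ordHull_eq hxab⟩
  · rintro ⟨a, b, h, rfl⟩
    obtain ⟨x, hx⟩ := exists_between h.lt
    exact ⟨x, (h.ordHull_eq hx).symm, g x, (IsBump.apply_mem_Ioo_iff h.left h.right).2 hx, x, hx,
      h.apply_ne x hx⟩

end Homeo

section Descent

/-- No strictly descending sequence of orbitals of elements of `Γ` exists. -/
def NoDescendingOrbitals (Γ : Subgroup HomeoI) : Prop :=
  ¬ ∃ U : ℕ → Set unitInterval, (∀ n, U (n + 1) ⊂ U n) ∧ ∀ n, ∃ g ∈ Γ, IsOrbitalOf g (U n)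

theorem Ioo_ssubset_Ioo {a b c d : unitInterval} (hcd : c < d) (hac : a ≤ c) (hdb : d ≤ b)
    (h : a < c ∨ d < b) : Ioo c d ⊂ Ioo a b := by
  refine ⟨Ioo_subset_Ioo hac hdb, fun H => ?_⟩
  rcases h with h | h
  · obtain ⟨z, hz⟩ := exists_between h
    exact hz.2.not_gt (H ⟨hz.1, hz.2.trans (hcd.trans_le hdb)⟩).1
  · obtain ⟨z, hz⟩ := exists_between h
    exact hz.1.not_gt (H ⟨hac.trans_lt (hcd.trans hz.1), hz.2⟩).2

namespace NoDescendingOrbitals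

variable {Γ : Subgroup HomeoI} (hΓ : NoDescendingOrbitals Γ) {g h : HomeoI} {a b : unitInterval}
include hΓ

theorem false_of_isBump {g : ℕ → HomeoI} {a b : ℕ → unitInterval} (hg : ∀ n, g n ∈ Γ)
    (hbump : ∀ n, IsBump (g n) (a n) (b n)) (ha : ∀ n, a n ≤ a (n + 1))
    (hb : ∀ n, b (n + 1) ≤ b n) (hab : ∀ n, a n < a (n + 1) ∨ b (n + 1) < b n) : False :=
  hΓ ⟨fun n => Ioo (a n) (b n),
    fun n => Ioo_ssubset_Ioo (hbump (n + 1)).lt (ha n) (hb n) (hab n),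
    fun n => ⟨g n, hg n, isOrbitalOf_iff.2 ⟨_, _, hbump n, rfl⟩⟩⟩

/-- An element mapping an orbital into itself preserves it. -/
theorem apply_eq_of_mapsTo (hg : g ∈ Γ) (hbump : IsBump g a b) (hh : h ∈ Γ)
    (ha : a ≤ h a) (hb : h b ≤ b) : h a = a ∧ h b = b := by
  by_contra H
  have H' : a < h a ∨ h b < b := by
    rcases ha.lt_or_eq with ha | ha
    · exact .inl ha
    · exact .inr (hb.lt_of_ne fun hb => H ⟨ha.symm, hb⟩)
  refine hΓ.false_of_isBump (g := fun n => h ^ n * g * (h ^ n)⁻¹)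
    (fun n => Γ.mul_mem (Γ.mul_mem (Γ.pow_mem hh n) hg) (Γ.inv_mem (Γ.pow_mem hh n)))
    (fun n => hbump.conj (h ^ n)) (fun n => ?_) (fun n => ?_) (fun n => ?_) <;>
    rw [pow_succ, mul_apply]
  · exact (h ^ n).monotone ha
  · exact (h ^ n).monotone hb
  · rw [mul_apply]
    exact H'.imp (fun H => (h ^ n).strictMono H) (fun H => (h ^ n).strictMono H)

/-- If `g` moves all points of `(a, b)` up and `h` has a fixed point `e` in `(a, b)`, then `h`
moves points less than `g` does: otherwise the orbitals of `g⁻¹ * h ^ n` around `e` descend. -/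
theorem apply_lt_apply_of_fixed (hg : g ∈ Γ) (hh : h ∈ Γ) (hga : g a = a) (hgb : g b = b)
    (hpos : ∀ x ∈ Ioo a b, x < g x) {e y : unitInterval} (he : e ∈ Ioo a b) (hhe : h e = e)
    (hy : y ∈ Ioo a b) (hey : e < y ∧ a ≤ h a ∨ y < e ∧ b ≤ h b) : h y < g y := by
  by_contra! hgy
  have hue (n : ℕ) : (g⁻¹ * h ^ (n + 1)) e < e := by
    rw [mul_apply, pow_apply_eq_of_apply_eq hhe]
    exact inv_apply_lt_iff.2 (hpos e he)
  choose c d hbump hmem using fun n => exists_isBump (hue n).ne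
  have hdown (n : ℕ) {z : unitInterval} (hz : z ∈ Ioo (c n) (d n)) :
      (g⁻¹ * h ^ (n + 1)) z < z := (hbump n).apply_lt (hmem n) (hue n) hz
  have hle {z : unitInterval} (hgz : g z ≤ h z) (hz : z ≤ h z) (n : ℕ) :
      z ≤ (g⁻¹ * h ^ (n + 1)) z := by
    rw [mul_apply, pow_succ, mul_apply]
    exact le_inv_apply_iff.2 (hgz.trans (le_pow_apply (h.monotone hz) n))
  have huy := hle hgy ((hpos y hy).le.trans hgy)
  have hends (n : ℕ) : a ≤ c n ∧ d n ≤ b ∧ (d n < b ∨ a < c n) := by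
    rcases hey with ⟨hey, ha⟩ | ⟨hey, hb⟩
    · have hdy : d n ≤ y := by
        by_contra! H
        exact (hdown n ⟨(hmem n).1.trans hey, H⟩).not_ge (huy n)
      refine ⟨?_, hdy.trans hy.2.le, .inl (hdy.trans_lt hy.2)⟩
      by_contra! H
      exact (hdown n ⟨H, he.1.trans (hmem n).2⟩).not_ge (hle (hga.trans_le ha) ha n)
    · have hcy : y ≤ c n := by
        by_contra! H
        exact (hdown n ⟨H, hey.trans (hmem n).2⟩).not_ge (huy n)
      refine ⟨hy.1.le.trans hcy, ?_, .inr (hy.1.trans_le hcy)⟩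
      by_contra! H
      exact (hdown n ⟨(hmem n).1.trans he.2, H⟩).not_ge (hle (hgb.trans_le hb) hb n)
  have hfix {n : ℕ} {r : unitInterval} (hr : (g⁻¹ * h ^ (n + 1)) r = r) :
      (h ^ (n + 1)) r = g r := by
    conv_rhs => rw [← hr, mul_apply, apply_inv_self]
  have hnext {n : ℕ} {r : unitInterval} (hr : (g⁻¹ * h ^ (n + 1)) r = r) (hgr : r ≤ g r) :
      r ≤ (g⁻¹ * h ^ (n + 1 + 1)) r := by
    have hhr : r ≤ h r := by
      by_contra! H
      exact (pow_succ_apply_lt H n).not_ge ((hfix hr).symm ▸ hgr)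
    rw [mul_apply, pow_succ _ (n + 1), mul_apply, le_inv_apply_iff, ← hfix hr]
    exact (h ^ (n + 1)).monotone hhr
  have hnext' {n : ℕ} {r : unitInterval} (hr : (g⁻¹ * h ^ (n + 1)) r = r) (hgr : r < g r) :
      r < (g⁻¹ * h ^ (n + 1 + 1)) r := by
    have hhr : r < h r := by
      by_contra! H
      exact (pow_apply_le H (n + 1)).not_gt ((hfix hr).symm ▸ hgr)
    rw [mul_apply, pow_succ _ (n + 1), mul_apply, lt_inv_apply_iff, ← hfix hr]
    exact (h ^ (n + 1)).strictMono hhr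
  have hnonneg {r : unitInterval} (har : a ≤ r) (hrb : r ≤ b) : r ≤ g r := by
    rcases har.eq_or_lt with rfl | har
    · exact hga.ge
    · rcases hrb.eq_or_lt with rfl | hrb
      · exact hgb.ge
      · exact (hpos r ⟨har, hrb⟩).le
  have hc (n : ℕ) : c n ≤ c (n + 1) := by
    by_contra! H
    exact (hdown (n + 1) ⟨H, (hmem n).1.trans (hmem (n + 1)).2⟩).not_ge
      (hnext (hbump n).left (hnonneg (hends n).1 ((hmem n).1.trans he.2).le))
  have hd (n : ℕ) : d (n + 1) ≤ d n := by
    by_contra! H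
    exact (hdown (n + 1) ⟨(hmem (n + 1)).1.trans (hmem n).2, H⟩).not_ge
      (hnext (hbump n).right (hnonneg (he.1.trans (hmem n).2).le (hends n).2.1))
  refine hΓ.false_of_isBump (fun n => Γ.mul_mem (Γ.inv_mem hg) (Γ.pow_mem hh (n + 1))) hbump
    hc hd fun n => ?_
  rcases (hends n).2.2 with H | H
  · refine .inr ((hd n).lt_of_ne fun heq => ?_)
    have := hnext' (hbump n).right (hpos (d n) ⟨he.1.trans (hmem n).2, H⟩)
    rw [← heq] at this
    exact this.ne' (hbump (n + 1)).right
  · refine .inl ((hc n).lt_of_ne fun heq => ?_)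
    have := hnext' (hbump n).left (hpos (c n) ⟨H, (hmem n).1.trans he.2⟩)
    rw [heq] at this
    exact this.ne' (hbump (n + 1)).left

/-- `Γ` preserves its inclusion-maximal orbitals. -/
theorem apply_eq_of_maximal (hg : g ∈ Γ) (hbump : IsBump g a b)
    (hmax : ∀ k ∈ Γ, ∀ c d, IsBump k c d → c ≤ a → b ≤ d → c = a ∧ d = b) (hh : h ∈ Γ) :
    h a = a ∧ h b = b := by
  wlog hpos : ∀ x ∈ Ioo a b, x < g x generalizing g
  · exact this (Γ.inv_mem hg) hbump.inv (hbump.forall_lt_or_forall_lt.resolve_left hpos)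
  have hright {k : HomeoI} (hk : k ∈ Γ) : k b ≤ b := by
    by_contra! hkb
    by_cases hfix : ∃ e ∈ Ioo a b, k e = e
    · obtain ⟨e, he, hke⟩ := hfix
      rcases le_or_gt a (k a) with hka | hka
      · obtain ⟨y, hy, hyb⟩ := exists_between (max_lt he.2 (inv_apply_lt_iff.2 hkb))
        obtain ⟨hey, hky⟩ := max_lt_iff.1 hy
        have hyab : y ∈ Ioo a b := ⟨he.1.trans hey, hyb⟩
        refine (hΓ.apply_lt_apply_of_fixed hg hk hbump.left hbump.right hpos he hke hyab
          (.inl ⟨hey, hka⟩)).not_gt ?_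
        exact ((IsBump.apply_mem_Ioo_iff hbump.left hbump.right).2 hyab).2.trans
          (inv_apply_lt_iff.1 hky)
      · have := hΓ.apply_eq_of_mapsTo hg hbump (Γ.inv_mem hk)
          (le_inv_apply_iff.2 hka.le) (inv_apply_le_iff.2 hkb.le)
        exact hkb.ne' (by simpa using inv_apply_eq_of_apply_eq this.2)
    · push Not at hfix
      obtain ⟨c, d, hcd, hb⟩ := exists_isBump hkb.ne'
      have hca : c ≤ a := by
        by_contra! H
        exact hfix c ⟨H, hb.1⟩ hcd.left
      exact hb.2.ne' (hmax k hk c d hcd hca hb.2.le).2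
  have hright' {k : HomeoI} (hk : k ∈ Γ) : k b = b :=
    le_antisymm (hright hk) (inv_apply_le_iff.1 (hright (Γ.inv_mem hk)))
  rcases le_total a (h a) with ha | ha
  · exact hΓ.apply_eq_of_mapsTo hg hbump hh ha (hright hh)
  · refine ⟨?_, hright' hh⟩
    have := hΓ.apply_eq_of_mapsTo hg hbump (Γ.inv_mem hh) (le_inv_apply_iff.2 ha)
      (hright (Γ.inv_mem hh))
    simpa using inv_apply_eq_of_apply_eq this.1

theorem isArchimedeanWeakOrder (hab : a < b) (hfix : ∀ h ∈ Γ, h a = a ∧ h b = b) :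
    IsArchimedeanWeakOrder fun f g : Γ => ∀ x ∈ Ioo a b, (f : HomeoI) x < (g : HomeoI) x := by
  have hmem {k : HomeoI} (hk : k ∈ Γ) {x : unitInterval} (hx : x ∈ Ioo a b) : k x ∈ Ioo a b :=
    (IsBump.apply_mem_Ioo_iff (hfix k hk).1 (hfix k hk).2).2 hx
  have hinf {f k : HomeoI} (hf : f ∈ Γ) (hk : k ∈ Γ) (hpos : ∀ x ∈ Ioo a b, x < f x)
      {e : unitInterval} (he : e ∈ Ioo a b) (hke : k e = e) {y : unitInterval}
      (hy : y ∈ Ioo a b) : k y < f y := by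
    rcases lt_trichotomy e y with hey | rfl | hey
    · exact hΓ.apply_lt_apply_of_fixed hf hk (hfix f hf).1 (hfix f hf).2 hpos he hke hy
        (.inl ⟨hey, (hfix k hk).1.ge⟩)
    · exact hke.trans_lt (hpos e he)
    · exact hΓ.apply_lt_apply_of_fixed hf hk (hfix f hf).1 (hfix f hf).2 hpos he hke hy
        (.inr ⟨hey, (hfix k hk).2.ge⟩)
  obtain ⟨x₀, hx₀⟩ := exists_between hab
  refine
    { irrefl := fun f H => (H x₀ hx₀).false
      trans := fun h₁ h₂ x hx => (h₁ x hx).trans (h₂ x hx)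
      cotrans := ?_
      mul_left := fun c H x hx => (c : HomeoI).strictMono (H x hx)
      mul_right := fun c H x hx => H _ (hmem c.2 hx)
      archimedean := ?_ }
  · rintro ⟨f, hf⟩ ⟨k, hk⟩ ⟨g, hg⟩ hfk
    by_contra! H
    simp only at hfk H
    obtain ⟨⟨x, hx, hgfx⟩, y, hy, hkgy⟩ := H
    have hf' := Γ.mul_mem (Γ.inv_mem hg) hf
    have hk' := Γ.mul_mem (Γ.inv_mem hg) hk
    have hlt : ∀ z ∈ Ioo a b, (g⁻¹ * f) z < (g⁻¹ * k) z := fun z hz =>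
      g⁻¹.strictMono (hfk z hz)
    have hx' : x ≤ (g⁻¹ * f) x := le_inv_apply_iff.2 hgfx
    have hy' : (g⁻¹ * k) y ≤ y := inv_apply_le_iff.2 hkgy
    generalize g⁻¹ * f = f' at *
    generalize g⁻¹ * k = k' at *
    obtain ⟨z, hz, hfz⟩ := exists_apply_eq_of_le_of_le hx hy hx' ((hlt y hy).le.trans hy')
    obtain ⟨e, he, hke⟩ := exists_apply_eq_of_le_of_le hx hy (hx'.trans (hlt x hx).le) hy'
    have := hinf (Γ.mul_mem hk' (Γ.inv_mem hf')) hk'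
      (fun w hw => by
        have := hlt _ (hmem (Γ.inv_mem hf') hw)
        rwa [apply_inv_self] at this) he hke hz
    rw [mul_apply, inv_apply_eq_of_apply_eq hfz] at this
    exact this.false
  · rintro ⟨p, hp⟩ hpos ⟨g, hg⟩
    have hbump : IsBump p a b :=
      ⟨hab, (hfix p hp).1, (hfix p hp).2, fun x hx => (hpos x hx).ne'⟩
    obtain ⟨n, hn⟩ := hbump.exists_zpow_le (hmem hg hx₀) hx₀
    suffices ∃ m : ℕ, g x₀ ≤ (p ^ m) x₀ from
      this.imp fun m hm H => (H x₀ hx₀).not_ge hm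
    obtain ⟨m, rfl | rfl⟩ := n.eq_nat_or_neg
    · refine ⟨0, le_trans ?_ hn⟩
      rw [zpow_natCast]
      exact le_pow_apply (hpos _ (hmem hg hx₀)).le m
    · refine ⟨m, inv_apply_le_iff.1 ?_⟩
      simpa using hn

/-- Orbitals of elements of the commutator subgroup are not maximal. -/
theorem exists_isBump_of_mem_commutator (hg : g ∈ ⁅Γ, Γ⁆) (hbump : IsBump g a b) :
    ∃ k ∈ Γ, ∃ c d, IsBump k c d ∧ Ioo a b ⊂ Ioo c d := by
  by_contra! H
  have hgΓ : g ∈ Γ := Subgroup.commutator_le_self Γ hg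
  have hmax : ∀ k ∈ Γ, ∀ c d, IsBump k c d → c ≤ a → b ≤ d → c = a ∧ d = b := by
    intro k hk c d hcd hca hbd
    by_contra hne
    refine H k hk c d hcd (Ioo_ssubset_Ioo hbump.lt hca hbd ?_)
    by_contra! H'
    exact hne ⟨le_antisymm hca H'.1, le_antisymm H'.2 hbd⟩
  have horder := hΓ.isArchimedeanWeakOrder hbump.lt fun h hh =>
    hΓ.apply_eq_of_maximal hgΓ hbump hmax hh
  rw [← Subgroup.map_subtype_commutator] at hg
  obtain ⟨x, hx, rfl⟩ := hg
  have hx' := horder.not_lt_of_mem_commutator hx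
  rcases hbump.forall_lt_or_forall_lt with hpos | hneg
  · exact hx'.1 hpos
  · exact hx'.2 fun y hy => lt_inv_apply_iff.1 (hneg y hy)

end NoDescendingOrbitals

end Descent

section Height

variable {Γ : Subgroup HomeoI}

/-- A chain of orbitals of elements of `Γ` has at most `height Γ` members. -/
theorem encard_le_height {S : Set (Set unitInterval)} (hS : IsChain (· ⊆ ·) S)
    (hΓ : ∀ A ∈ S, ∃ g ∈ Γ, IsOrbitalOf g A) : S.encard ≤ height Γ := by
  choose! g hg hgA using hΓ
  have hT : IsTower Γ ((fun A => (A, g A)) '' S) := by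
    refine ⟨?_, ?_, ?_⟩
    · rintro _ ⟨A, hA, rfl⟩
      exact ⟨hg A hA, hgA A hA⟩
    · rintro _ ⟨A, hA, rfl⟩ _ ⟨B, hB, rfl⟩
      exact hS.total hA hB
    · rintro _ ⟨A, hA, rfl⟩ _ ⟨B, hB, rfl⟩ h
      obtain rfl : A = B := h
      rfl
  have hS' : S = towerOrbitals ((fun A => (A, g A)) '' S) := by
    simp [towerOrbitals, image_image]
  rw [hS']
  exact le_iSup₂ (f := fun T (_ : T ∈ {T | IsTower Γ T}) => (towerOrbitals T).encard) _ hT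

theorem noDescendingOrbitals_of_height_ne_top (h : height Γ ≠ ⊤) : NoDescendingOrbitals Γ := by
  rintro ⟨U, hU, hΓ⟩
  have hanti : StrictAnti U := strictAnti_nat_of_succ_lt hU
  have := encard_le_height (S := range U) hanti.antitone.isChain_range
    (by rintro _ ⟨n, rfl⟩; exact hΓ n)
  rw [(infinite_range_of_injective hanti.injective).encard_eq, top_le_iff] at this
  exact h this

theorem NoDescendingOrbitals.mono {Δ : Subgroup HomeoI} (hΓ : NoDescendingOrbitals Γ)
    (hΔ : Δ ≤ Γ) : NoDescendingOrbitals Δ := fun ⟨U, hU, h⟩ =>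
  hΓ ⟨U, hU, fun n => (h n).imp fun _ hg => ⟨hΔ hg.1, hg.2⟩⟩

/-- An orbital of an element of the `n`-th derived subgroup is the bottom of a chain of `n + 1`
orbitals. -/
theorem exists_chain_of_mem_derivedSeries (hΓ : NoDescendingOrbitals Γ) (n : ℕ) {g : Γ}
    (hg : g ∈ derivedSeries Γ n) {a b : unitInterval} (hbump : IsBump g a b) :
    ∃ S : Set (Set unitInterval), IsChain (· ⊆ ·) S ∧ S.encard = n + 1 ∧
      (∀ A ∈ S, Ioo a b ⊆ A) ∧ ∀ A ∈ S, ∃ k ∈ Γ, IsOrbitalOf k A := by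
  induction n generalizing g a b with
  | zero =>
    refine ⟨{Ioo a b}, IsChain.singleton, by simp, by simp, ?_⟩
    rintro _ rfl
    exact ⟨g, g.2, isOrbitalOf_iff.2 ⟨a, b, hbump, rfl⟩⟩
  | succ n ih =>
    have hg' : (g : HomeoI) ∈
        ⁅(derivedSeries Γ n).map Γ.subtype, (derivedSeries Γ n).map Γ.subtype⁆ := by
      rw [← Subgroup.map_commutator]
      exact ⟨g, hg, rfl⟩
    obtain ⟨_, ⟨k, hk, rfl⟩, c, d, hcd, hlt⟩ :=
      (hΓ.mono (Subgroup.map_subtype_le _)).exists_isBump_of_mem_commutator hg' hbump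
    obtain ⟨S, hS, hcard, hbot, horb⟩ := ih hk hcd
    refine ⟨insert (Ioo a b) S, hS.insert fun A hA _ => .inl (hlt.1.trans (hbot A hA)), ?_, ?_,
      ?_⟩
    · rw [encard_insert_of_notMem fun H => hlt.2 (hbot _ H), hcard]
      push_cast
      rfl
    · rintro A (rfl | hA)
      exacts [Subset.rfl, hlt.1.trans (hbot A hA)]
    · rintro A (rfl | hA)
      exacts [⟨g, g.2, isOrbitalOf_iff.2 ⟨a, b, hbump, rfl⟩⟩, horb A hA]

end Height

/-- If a subgroup `Γ ≤ Homeo₊(I)` has height exactly `N < ∞`, then `Γ` is solvable of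
solvability degree at most `N`. -/
theorem solvable_of_height_eq (Γ : Subgroup HomeoI) (N : ℕ)
    (hN : height Γ = (N : ℕ∞)) :
    derivedSeries ↥Γ N = ⊥ := by
  rw [eq_bot_iff]
  intro g hg
  by_contra hne
  obtain ⟨x, hx⟩ : ∃ x, (g : HomeoI) x ≠ x := by
    by_contra! H
    exact hne (Subtype.ext (RelIso.ext H))
  obtain ⟨a, b, hbump, -⟩ := exists_isBump hx
  obtain ⟨S, hS, hcard, -, horb⟩ := exists_chain_of_mem_derivedSeries
    (noDescendingOrbitals_of_height_ne_top (hN ▸ ENat.natCast_ne_top N)) N hg hbump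
  have := encard_le_height hS horb
  rw [hN, hcard] at this
  norm_cast at this
  omega

end HeightHomeo
end

section
/- There exists a subgroup Γ of Homeo₊(I) generated by two homeomorphisms such that Γ is solvable of solvability degree exactly two (metabelian but not abelian) and h_strict(Γ) = ∞, i.e. Γ admits strict towers of arbitrarily large finite cardinality. -/
open Set

namespace HeightHomeo

section Completion

variable {L X : Type*} [CompleteLinearOrder L] [LinearOrder X]

/-- The extension to a complete linear order `L` of an order automorphism of a suborder
`ι : X ↪o L`. -/
def completionMap (ι : X ↪o L) (σ : X ≃o X) (x : L) : L :=
  sSup {y | ∃ d, ι d < x ∧ y = ι (σ d)}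

theorem completionMap_monotone (ι : X ↪o L) (σ : X ≃o X) : Monotone (completionMap ι σ) := by
  intro x y hxy
  refine sSup_le_sSup ?_
  rintro _ ⟨d, hd, rfl⟩
  exact ⟨d, hd.trans_le hxy, rfl⟩

variable {ι : X ↪o L}

theorem completionMap_one
    (hι : ∀ x y : L, x < y → ∃ d, x < ι d ∧ ι d < y) (x : L) : completionMap ι 1 x = x := by
  refine le_antisymm (sSup_le ?_) (le_of_forall_lt fun y hy => ?_)
  · rintro _ ⟨d, hd, rfl⟩
    exact hd.le
  · obtain ⟨d, hyd, hdx⟩ := hι y x hy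
    exact hyd.trans_le (le_sSup ⟨d, hdx, rfl⟩)

theorem completionMap_embedding
    (hι : ∀ x y : L, x < y → ∃ d, x < ι d ∧ ι d < y) (σ : X ≃o X) (d : X) :
    completionMap ι σ (ι d) = ι (σ d) := by
  refine le_antisymm (sSup_le ?_) (le_of_forall_lt fun y hy => ?_)
  · rintro _ ⟨c, hc, rfl⟩
    exact ι.monotone (σ.monotone (ι.lt_iff_lt.1 hc).le)
  · obtain ⟨c, hyc, hcd⟩ := hι y _ hy
    refine hyc.trans_le (le_sSup ⟨σ.symm c, ?_, by rw [σ.apply_symm_apply]⟩)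
    rw [ι.lt_iff_lt] at hcd ⊢
    exact σ.symm_apply_lt.2 hcd

theorem completionMap_mul
    (hι : ∀ x y : L, x < y → ∃ d, x < ι d ∧ ι d < y) (σ τ : X ≃o X) (x : L) :
    completionMap ι (σ * τ) x = completionMap ι σ (completionMap ι τ x) := by
  refine le_antisymm (sSup_le ?_) (sSup_le ?_)
  · rintro _ ⟨d, hd, rfl⟩
    calc ι (σ (τ d)) = completionMap ι σ (completionMap ι τ (ι d)) := by
          rw [completionMap_embedding hι, completionMap_embedding hι]
      _ ≤ _ := completionMap_monotone ι σ (completionMap_monotone ι τ hd.le)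
  · rintro _ ⟨d, hd, rfl⟩
    obtain ⟨_, ⟨c, hc, rfl⟩, hdc⟩ := lt_sSup_iff.1 hd
    exact (ι.monotone (σ.monotone (ι.lt_iff_lt.1 hdc).le)).trans (le_sSup ⟨c, hc, rfl⟩)

/-- The action on a complete linear order of the order automorphisms of a dense suborder. -/
def completionHom
    (hι : ∀ x y : L, x < y → ∃ d, x < ι d ∧ ι d < y) : (X ≃o X) →* (L ≃o L) where
  toFun σ := Equiv.toOrderIso
    { toFun := completionMap ι σ
      invFun := completionMap ι σ⁻¹
      left_inv := fun x => by
        rw [← completionMap_mul hι, inv_mul_cancel, completionMap_one hι]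
      right_inv := fun x => by
        rw [← completionMap_mul hι, mul_inv_cancel, completionMap_one hι] }
    (completionMap_monotone ι σ) (completionMap_monotone ι σ⁻¹)
  map_one' := OrderIso.ext (funext (completionMap_one hι))
  map_mul' σ τ := OrderIso.ext (funext (completionMap_mul hι σ τ))

theorem completionHom_embedding
    (hι : ∀ x y : L, x < y → ∃ d, x < ι d ∧ ι d < y) (σ : X ≃o X) (d : X) :
    completionHom hι σ (ι d) = ι (σ d) :=
  completionMap_embedding hι σ d

theorem completionHom_injective
    (hι : ∀ x y : L, x < y → ∃ d, x < ι d ∧ ι d < y) : Function.Injective (completionHom hι) := by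
  intro σ τ h
  ext d
  apply ι.injective
  rw [← completionHom_embedding hι, ← completionHom_embedding hι, h]

end Completion

/-- A countable dense linear order without endpoints embeds densely in the unit interval. -/
theorem exists_dense_embedding_unitInterval (X : Type*) [LinearOrder X] [Countable X]
    [DenselyOrdered X] [NoMinOrder X] [NoMaxOrder X] [Nonempty X] :
    ∃ ι : X ↪o unitInterval, ∀ x y, x < y → ∃ d, x < ι d ∧ ι d < y := by
  have : Nonempty (Ioo (0 : ℚ) 1) := ⟨⟨1 / 2, by norm_num, by norm_num⟩⟩
  obtain ⟨e⟩ := Order.iso_of_countable_dense X (Ioo (0 : ℚ) 1)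
  let j : Ioo (0 : ℚ) 1 ↪o unitInterval := OrderEmbedding.ofStrictMono
    (fun q => ⟨((q : ℚ) : ℝ), by exact_mod_cast q.2.1.le, by exact_mod_cast q.2.2.le⟩)
    (fun p q h => Subtype.mk_lt_mk.2 (by exact_mod_cast h))
  refine ⟨e.toOrderEmbedding.trans j, fun x y hxy => ?_⟩
  obtain ⟨q, hxq, hqy⟩ := exists_rat_btwn (Subtype.coe_lt_coe.2 hxy)
  have h0 : (0 : ℚ) < q := by exact_mod_cast x.2.1.trans_lt hxq
  have h1 : q < 1 := by exact_mod_cast hqy.trans_le y.2.2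
  refine ⟨e.symm ⟨q, h0, h1⟩, ?_, ?_⟩
  · change x < j (e (e.symm _))
    rw [e.apply_symm_apply]
    exact hxq
  · change j (e (e.symm _)) < y
    rw [e.apply_symm_apply]
    exact hqy

/-- The group of finitely supported integer sequences indexed by `ℤ`, with the lexicographic
order. -/
abbrev LexSeq := Lex (ℤ →₀ ℤ)

namespace LexSeq

/-- The sequence with value `n` at `k` and zero elsewhere. -/
noncomputable def single (k n : ℤ) : LexSeq := toLex (Finsupp.single k n)

theorem single_apply (k n i : ℤ) : ofLex (single k n) i = if k = i then n else 0 :=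
  Finsupp.single_apply

theorem single_zero (k : ℤ) : single k 0 = 0 := Finsupp.single_zero k

theorem zsmul_single (k m n : ℤ) : m • single k n = single k (m * n) :=
  Finsupp.smul_single m k n

theorem single_lt_single {k m n : ℤ} (h : m < n) : single k m < single k n := by
  refine Finsupp.Lex.lt_iff.2 ⟨k, fun i hi => ?_, ?_⟩
  · rw [single_apply, single_apply, if_neg hi.ne', if_neg hi.ne']
  · simpa only [single_apply, if_true] using h

theorem single_lt_single_of_lt {j k : ℤ} (h : j < k) {m : ℤ} (hm : 0 < m) (n : ℤ) :
    single k n < single j m := by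
  refine Finsupp.Lex.lt_iff.2 ⟨j, fun i hi => ?_, ?_⟩
  · rw [single_apply, single_apply, if_neg hi.ne', if_neg (hi.trans h).ne']
  · simpa only [single_apply, if_true, if_neg h.ne'] using hm

theorem single_lt_single_of_gt {j k : ℤ} (h : j < k) {m : ℤ} (hm : m < 0) (n : ℤ) :
    single j m < single k n := by
  refine Finsupp.Lex.lt_iff.2 ⟨j, fun i hi => ?_, ?_⟩
  · rw [single_apply, single_apply, if_neg hi.ne', if_neg (hi.trans h).ne']
  · simpa only [single_apply, if_true, if_neg h.ne'] using hm

theorem single_pos (k : ℤ) {n : ℤ} (h : 0 < n) : 0 < single k n := by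
  simpa only [single_zero] using single_lt_single (k := k) h

instance : Countable LexSeq := inferInstanceAs (Countable (ℤ →₀ ℤ))

instance : NoMaxOrder LexSeq :=
  ⟨fun x => ⟨x + single 0 1, lt_add_of_pos_right x (single_pos 0 one_pos)⟩⟩

instance : NoMinOrder LexSeq :=
  ⟨fun x => ⟨x - single 0 1, sub_lt_self x (single_pos 0 one_pos)⟩⟩

instance : DenselyOrdered LexSeq where
  dense x y hxy := by
    obtain ⟨i, hi, hxyi⟩ := Finsupp.Lex.lt_iff.1 hxy
    refine ⟨x + single (i + 1) 1, lt_add_of_pos_right x (single_pos _ one_pos),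
      Finsupp.Lex.lt_iff.2 ⟨i, fun k hk => ?_, ?_⟩⟩
    · change ofLex x k + ofLex (single (i + 1) 1) k = ofLex y k
      rw [single_apply, if_neg (by omega), add_zero, hi k hk]
    · change ofLex x i + ofLex (single (i + 1) 1) i < ofLex y i
      rwa [single_apply, if_neg (by omega), add_zero]

/-- The additive automorphism of `LexSeq` shifting all the indices by one. -/
noncomputable def shiftAddEquiv : LexSeq ≃+ LexSeq :=
  (Finsupp.domCongr (Equiv.addRight (1 : ℤ)) : (ℤ →₀ ℤ) ≃+ (ℤ →₀ ℤ))

theorem shiftAddEquiv_apply (x : LexSeq) (i : ℤ) : 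
    ofLex (shiftAddEquiv x) i = ofLex x (i - 1) := rfl

theorem shiftAddEquiv_strictMono : StrictMono shiftAddEquiv := by
  intro x y hxy
  obtain ⟨i, hi, hxyi⟩ := Finsupp.Lex.lt_iff.1 hxy
  refine Finsupp.Lex.lt_iff.2 ⟨i + 1, fun k hk => ?_, ?_⟩
  · rw [shiftAddEquiv_apply, shiftAddEquiv_apply, hi _ (by omega)]
  · rwa [shiftAddEquiv_apply, shiftAddEquiv_apply, add_sub_cancel_right]

/-- The shift of indices by one, as an order automorphism. -/
noncomputable def shift : LexSeq ≃o LexSeq where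
  toEquiv := shiftAddEquiv.toEquiv
  map_rel_iff' := shiftAddEquiv_strictMono.le_iff_le

theorem shift_add (x y : LexSeq) : shift (x + y) = shift x + shift y :=
  map_add shiftAddEquiv x y

theorem shift_single (k n : ℤ) : shift (single k n) = single (k + 1) n :=
  Finsupp.equivMapDomain_single (Equiv.addRight (1 : ℤ)) k n

/-- The action of `LexSeq` on itself by translations. -/
noncomputable def translation : Multiplicative LexSeq →* (LexSeq ≃o LexSeq) where
  toFun v := OrderIso.addLeft v.toAdd
  map_one' := OrderIso.ext (funext fun x => zero_add x)
  map_mul' v w := OrderIso.ext (funext fun x => add_assoc v.toAdd w.toAdd x)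

theorem translation_apply (v : Multiplicative LexSeq) (x : LexSeq) :
    translation v x = v.toAdd + x := rfl

theorem shift_conj_translation (v : LexSeq) :
    shift * translation (.ofAdd v) * shift⁻¹ = translation (.ofAdd (shift v)) := by
  rw [mul_inv_eq_iff_eq_mul]
  exact OrderIso.ext (funext fun x => shift_add v x)

/-- `g` is affine with linear part the `n`-th power of the shift. -/
def IsAffine (n : ℤ) (g : LexSeq ≃o LexSeq) : Prop :=
  ∀ v x, g (v + x) = (shift ^ n) v + g x

theorem IsAffine.mul {m n : ℤ} {g h : LexSeq ≃o LexSeq} (hg : IsAffine m g)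
    (hh : IsAffine n h) : IsAffine (m + n) (g * h) := by
  intro v x
  rw [zpow_add]
  change g (h (v + x)) = (shift ^ m) ((shift ^ n) v) + g (h x)
  rw [hh, hg]

theorem IsAffine.inv {n : ℤ} {g : LexSeq ≃o LexSeq} (hg : IsAffine n g) :
    IsAffine (-n) g⁻¹ := by
  intro v x
  apply g.injective
  rw [hg, zpow_neg]
  change g (g.symm (v + x)) = (shift ^ n) ((shift ^ n).symm v) + g (g.symm x)
  simp only [OrderIso.apply_symm_apply]

theorem isAffine_shift : IsAffine 1 shift := by
  intro v x
  rw [zpow_one, shift_add]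

theorem isAffine_translation (v : Multiplicative LexSeq) : IsAffine 0 (translation v) :=
  fun w x => add_left_comm v.toAdd w x

theorem IsAffine.eq_translation {g : LexSeq ≃o LexSeq} (hg : IsAffine 0 g) :
    g = translation (.ofAdd (g 0)) := by
  ext x
  have h := hg x 0
  rw [add_zero, zpow_zero] at h
  rw [h, translation_apply]
  exact add_comm x (g 0)

/-- The group of order automorphisms of `LexSeq` generated by the shift and a translation. -/
noncomputable def shiftTranslationGroup : Subgroup (LexSeq ≃o LexSeq) :=
  Subgroup.closure {shift, translation (.ofAdd (single 0 1))}

theorem exists_isAffine {g : LexSeq ≃o LexSeq} (hg : g ∈ shiftTranslationGroup) :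
    ∃ n, IsAffine n g := by
  induction hg using Subgroup.closure_induction with
  | mem g hg =>
    rcases hg with rfl | rfl
    · exact ⟨1, isAffine_shift⟩
    · exact ⟨0, isAffine_translation _⟩
  | one => exact ⟨0, map_one translation ▸ isAffine_translation 1⟩
  | mul g h _ _ hg hh =>
    obtain ⟨m, hm⟩ := hg
    obtain ⟨n, hn⟩ := hh
    exact ⟨m + n, hm.mul hn⟩
  | inv g _ hg =>
    obtain ⟨n, hn⟩ := hg
    exact ⟨-n, hn.inv⟩

open scoped commutatorElement in
theorem commutatorElement_mem_range_translation {g h : LexSeq ≃o LexSeq}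
    (hg : g ∈ shiftTranslationGroup) (hh : h ∈ shiftTranslationGroup) :
    ⁅g, h⁆ ∈ translation.range := by
  obtain ⟨m, hm⟩ := exists_isAffine hg
  obtain ⟨n, hn⟩ := exists_isAffine hh
  have hc := ((hm.mul hn).mul hm.inv).mul hn.inv
  rw [show m + n + -m + -n = 0 by ring] at hc
  exact ⟨_, hc.eq_translation.symm⟩

theorem translation_single_mem (k : ℕ) :
    translation (.ofAdd (single k 1)) ∈ shiftTranslationGroup := by
  induction k with
  | zero => exact Subgroup.subset_closure (Or.inr rfl)
  | succ k ih =>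
    have hs : shift ∈ shiftTranslationGroup := Subgroup.subset_closure (Or.inl rfl)
    rw [Nat.cast_succ, ← shift_single, ← shift_conj_translation]
    exact mul_mem (mul_mem hs ih) (inv_mem hs)

theorem derivedSeries_two_shiftTranslationGroup :
    derivedSeries shiftTranslationGroup 2 = ⊥ := by
  have hle : derivedSeries shiftTranslationGroup 1 ≤
      translation.range.subgroupOf shiftTranslationGroup := by
    rw [derivedSeries_succ, Subgroup.commutator_le]
    exact fun g _ h _ => commutatorElement_mem_range_translation g.2 h.2
  rw [derivedSeries_succ, eq_bot_iff, Subgroup.commutator_le]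
  intro g hg h hh
  obtain ⟨v, hv⟩ := hle hg
  obtain ⟨w, hw⟩ := hle hh
  rw [Subgroup.mem_bot, commutatorElement_eq_one_iff_mul_comm]
  apply Subtype.ext
  change shiftTranslationGroup.subtype g * shiftTranslationGroup.subtype h =
    shiftTranslationGroup.subtype h * shiftTranslationGroup.subtype g
  rw [← hv, ← hw, ← map_mul, ← map_mul, mul_comm]

open scoped commutatorElement in
theorem derivedSeries_one_shiftTranslationGroup :
    derivedSeries shiftTranslationGroup 1 ≠ ⊥ := by
  intro hbot
  let s : shiftTranslationGroup := ⟨shift, Subgroup.subset_closure (Or.inl rfl)⟩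
  let t : shiftTranslationGroup :=
    ⟨translation (.ofAdd (single 0 1)), Subgroup.subset_closure (Or.inr rfl)⟩
  have hst : ⁅s, t⁆ ∈ derivedSeries shiftTranslationGroup 1 := by
    rw [derivedSeries_succ]
    exact Subgroup.commutator_mem_commutator (Subgroup.mem_top s) (Subgroup.mem_top t)
  rw [hbot, Subgroup.mem_bot, commutatorElement_eq_one_iff_mul_comm] at hst
  have h := congrArg (fun g : shiftTranslationGroup => (g : LexSeq ≃o LexSeq) 0) hst
  change shift (single 0 1 + 0) = single 0 1 + shift 0 at h
  have h0 : shift 0 = 0 := map_zero shiftAddEquiv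
  rw [add_zero, h0, add_zero, shift_single] at h
  exact (single_lt_single_of_lt zero_lt_one one_pos 1).ne h

end LexSeq

theorem derivedSeries_map_eq_bot_iff {G H : Type*} [Group G] [Group H] {f : G →* H}
    (hf : Function.Injective f) (K : Subgroup G) (n : ℕ) :
    derivedSeries (K.map f) n = ⊥ ↔ derivedSeries K n = ⊥ := by
  let e := K.equivMapOfInjective f hf
  rw [← map_derivedSeries_eq (f := e.toMonoidHom) e.surjective n]
  exact Subgroup.map_eq_bot_iff_of_injective _ e.injective

theorem bddBelow_coe_image (A : Set unitInterval) :
    BddBelow ((fun x : unitInterval => (x : ℝ)) '' A) :=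
  ⟨0, by rintro _ ⟨x, _, rfl⟩; exact x.2.1⟩

theorem bddAbove_coe_image (A : Set unitInterval) :
    BddAbove ((fun x : unitInterval => (x : ℝ)) '' A) :=
  ⟨1, by rintro _ ⟨x, _, rfl⟩; exact x.2.2⟩

theorem subset_ordHull (S : Set unitInterval) : S ⊆ ordHull S :=
  fun x hx => ⟨x, hx, x, hx, le_rfl, le_rfl⟩

theorem leftEnd_lt_of_subset_Icc {A B : Set unitInterval} (hB : B.Nonempty) {a b x : unitInterval}
    (hBA : B ⊆ Icc a b) (hx : x ∈ A) (hxa : x < a) : leftEnd A < leftEnd B := by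
  refine (csInf_le (bddBelow_coe_image A) (mem_image_of_mem _ hx)).trans_lt
    ((Subtype.coe_lt_coe.2 hxa).trans_le (le_csInf (hB.image _) ?_))
  rintro _ ⟨y, hy, rfl⟩
  exact (hBA hy).1

theorem rightEnd_lt_of_subset_Icc {A B : Set unitInterval} (hB : B.Nonempty) {a b x : unitInterval}
    (hBA : B ⊆ Icc a b) (hx : x ∈ A) (hbx : b < x) : rightEnd B < rightEnd A := by
  refine lt_of_le_of_lt (csSup_le (hB.image _) ?_)
    ((Subtype.coe_lt_coe.2 hbx).trans_le
      (le_csSup (bddAbove_coe_image A) (mem_image_of_mem _ hx)))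
  rintro _ ⟨y, hy, rfl⟩
  exact (hBA hy).2

/-- A sequence of orbitals, each contained in the previous ones without sharing an end with
them, yields infinite strict height. -/
theorem strictHeight_eq_top_of_sequence {Γ : Subgroup HomeoI} (B : ℕ → Set unitInterval)
    (g : ℕ → HomeoI) (hΓ : ∀ k, g k ∈ Γ) (horb : ∀ k, IsOrbitalOf (g k) (B k))
    (hB : ∀ j k, j < k → B k ⊆ B j ∧ leftEnd (B j) < leftEnd (B k) ∧
      rightEnd (B k) < rightEnd (B j)) :
    strictHeight Γ = ⊤ := by
  have hleft : StrictMono fun k => leftEnd (B k) := fun j k h => (hB j k h).2.1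
  have hright : StrictAnti fun k => rightEnd (B k) := fun j k h => (hB j k h).2.2
  have hinj : Function.Injective B := fun j k h => hleft.injective (congrArg leftEnd h)
  have htower : IsStrictTower Γ (range fun k => (B k, g k)) := by
    refine ⟨⟨?_, ?_, ?_⟩, ?_⟩
    · rintro _ ⟨k, rfl⟩
      exact ⟨hΓ k, horb k⟩
    · rintro _ ⟨j, rfl⟩ _ ⟨k, rfl⟩
      rcases lt_trichotomy j k with h | rfl | h
      · exact Or.inr (hB j k h).1
      · exact Or.inl Subset.rfl
      · exact Or.inl (hB k j h).1
    · rintro _ ⟨j, rfl⟩ _ ⟨k, rfl⟩ h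
      obtain rfl := hinj h
      rfl
    · rintro _ ⟨j, rfl⟩ _ ⟨k, rfl⟩ h
      have hjk : j ≠ k := fun hjk => h (congrArg B hjk)
      exact not_or.2 ⟨hleft.injective.ne hjk, hright.injective.ne hjk⟩
  have hcard : (towerOrbitals (range fun k => (B k, g k))).encard = ⊤ := by
    rw [towerOrbitals, ← range_comp, encard_eq_top_iff]
    exact infinite_range_of_injective hinj
  exact eq_top_iff.2 (hcard ▸ le_iSup₂ (f := fun T (_ : T ∈ {T | IsStrictTower Γ T}) =>
    (towerOrbitals T).encard) _ htower)

section Orbitals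

variable {ι : LexSeq ↪o unitInterval} (hι : ∀ x y, x < y → ∃ d, x < ι d ∧ ι d < y)

/-- The convex hull in the unit interval of the multiples of `LexSeq.single k 1`. -/
def singleHull (ι : LexSeq ↪o unitInterval) (k : ℤ) : Set unitInterval :=
  ordHull (range fun n : ℤ => ι (LexSeq.single k n))

theorem embedding_single_mem_singleHull (ι : LexSeq ↪o unitInterval) (k n : ℤ) :
    ι (LexSeq.single k n) ∈ singleHull ι k :=
  subset_ordHull _ ⟨n, rfl⟩

theorem isOrbitalOf_singleHull (k : ℤ) :
    IsOrbitalOf (completionHom hι (LexSeq.translation (.ofAdd (LexSeq.single k 1))))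
      (singleHull ι k) := by
  refine ⟨ι 0, ?_, ι (LexSeq.single k 0), embedding_single_mem_singleHull ι k 0,
    ι (LexSeq.single k 1), embedding_single_mem_singleHull ι k 1,
    ι.injective.ne (LexSeq.single_lt_single one_pos).ne⟩
  unfold singleHull
  congr 2
  funext n
  rw [← map_zpow, completionHom_embedding hι, ← map_zpow, ← ofAdd_zsmul,
    LexSeq.zsmul_single, LexSeq.translation_apply, toAdd_ofAdd, add_zero, mul_one]

theorem singleHull_subset_Icc (ι : LexSeq ↪o unitInterval) {j k : ℤ} (h : j < k) :
    singleHull ι k ⊆ Icc (ι (LexSeq.single j (-1))) (ι (LexSeq.single j 1)) := by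
  rintro y ⟨_, ⟨m, rfl⟩, _, ⟨n, rfl⟩, hmy, hyn⟩
  exact ⟨(ι.monotone (LexSeq.single_lt_single_of_gt h (by norm_num) m).le).trans hmy,
    hyn.trans (ι.monotone (LexSeq.single_lt_single_of_lt h one_pos n).le)⟩

theorem singleHull_strictly_nested (ι : LexSeq ↪o unitInterval) {j k : ℤ} (h : j < k) :
    singleHull ι k ⊆ singleHull ι j ∧ leftEnd (singleHull ι j) < leftEnd (singleHull ι k) ∧
      rightEnd (singleHull ι k) < rightEnd (singleHull ι j) := by
  have hne : (singleHull ι k).Nonempty := ⟨_, embedding_single_mem_singleHull ι k 0⟩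
  have hsub := singleHull_subset_Icc ι h
  refine ⟨fun y hy => ⟨_, ⟨-1, rfl⟩, _, ⟨1, rfl⟩, (hsub hy).1, (hsub hy).2⟩,
    leftEnd_lt_of_subset_Icc hne hsub (embedding_single_mem_singleHull ι j (-2)) ?_,
    rightEnd_lt_of_subset_Icc hne hsub (embedding_single_mem_singleHull ι j 2) ?_⟩
  · exact ι.strictMono (LexSeq.single_lt_single (by norm_num))
  · exact ι.strictMono (LexSeq.single_lt_single (by norm_num))

end Orbitals

/-- There is a two-generated subgroup `Γ ≤ Homeo₊(I)` which is solvable of solvability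
degree exactly two (metabelian but not Abelian) and has infinite strict height. -/
theorem exists_metabelian_two_generated_infinite_strictHeight :
    ∃ Γ : Subgroup HomeoI, ∃ f g : HomeoI,
      Γ = Subgroup.closure {f, g} ∧
      derivedSeries ↥Γ 2 = ⊥ ∧
      derivedSeries ↥Γ 1 ≠ ⊥ ∧
      strictHeight Γ = ⊤ := by
  obtain ⟨ι, hι⟩ := exists_dense_embedding_unitInterval LexSeq
  let F := completionHom hι
  have hF : Function.Injective F := completionHom_injective hι
  refine ⟨LexSeq.shiftTranslationGroup.map F, F LexSeq.shift,
    F (LexSeq.translation (.ofAdd (LexSeq.single 0 1))), ?_, ?_, ?_, ?_⟩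
  · rw [LexSeq.shiftTranslationGroup, MonoidHom.map_closure, image_pair]
  · exact (derivedSeries_map_eq_bot_iff hF _ 2).2
      LexSeq.derivedSeries_two_shiftTranslationGroup
  · exact (derivedSeries_map_eq_bot_iff hF _ 1).not.2
      LexSeq.derivedSeries_one_shiftTranslationGroup
  · exact strictHeight_eq_top_of_sequence (fun k => singleHull ι k)
      (fun k => F (LexSeq.translation (.ofAdd (LexSeq.single k 1))))
      (fun k => Subgroup.mem_map_of_mem F (LexSeq.translation_single_mem k))
      (fun k => isOrbitalOf_singleHull hι k)
      (fun j k h => singleHull_strictly_nested ι (Nat.cast_lt.2 h))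

end HeightHomeo
end

section
/- Every subgroup Γ ≤ Homeo₊(I) with h(Γ) = 1 is Abelian. -/
open Set

namespace HeightHomeo

section Orbit

variable {α : Type*} [LinearOrder α]

/-- The convex hull of the orbit of `x` under the cyclic group generated by `g`. -/
def orbitHull (g : α ≃o α) (x : α) : Set α :=
  {y | ∃ m n : ℤ, (g ^ m) x ≤ y ∧ y ≤ (g ^ n) x}

theorem mul_app (f g : α ≃o α) (x : α) : (f * g) x = f (g x) := rfl

theorem one_app (x : α) : (1 : α ≃o α) x = x := rfl

theorem inv_app_self (f : α ≃o α) (x : α) : f⁻¹ (f x) = x := f.symm_apply_apply x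

theorem app_inv_self (f : α ≃o α) (x : α) : f (f⁻¹ x) = x := f.apply_symm_apply x

theorem inv_lt_iff (f : α ≃o α) {x y : α} : f⁻¹ x < y ↔ x < f y := by
  rw [← f.lt_iff_lt, app_inv_self]

theorem lt_inv_iff (f : α ≃o α) {x y : α} : x < f⁻¹ y ↔ f x < y := by
  rw [← f.lt_iff_lt, app_inv_self]

theorem inv_le_iff (f : α ≃o α) {x y : α} : f⁻¹ x ≤ y ↔ x ≤ f y := by
  rw [← f.le_iff_le, app_inv_self]

theorem le_inv_iff (f : α ≃o α) {x y : α} : x ≤ f⁻¹ y ↔ f x ≤ y := by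
  rw [← f.le_iff_le, app_inv_self]

theorem inv_app_eq_of_fixed {f : α ≃o α} {x : α} (h : f x = x) : f⁻¹ x = x := by
  conv_lhs => rw [← h]
  exact inv_app_self f x

theorem zpow_add_app (g : α ≃o α) (m n : ℤ) (x : α) :
    (g ^ (m + n)) x = (g ^ m) ((g ^ n) x) := by
  rw [zpow_add, mul_app]

theorem zpow_succ_app (g : α ≃o α) (m : ℤ) (x : α) : (g ^ (m + 1)) x = g ((g ^ m) x) := by
  rw [add_comm, zpow_add_app, zpow_one]

theorem self_mem_orbitHull (g : α ≃o α) (x : α) : x ∈ orbitHull g x :=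
  ⟨0, 0, by rw [zpow_zero, one_app], by rw [zpow_zero, one_app]⟩

theorem mem_orbitHull_of_le_of_le {g : α ≃o α} {x y z w : α} (hy : y ∈ orbitHull g x)
    (hw : w ∈ orbitHull g x) (hyz : y ≤ z) (hzw : z ≤ w) : z ∈ orbitHull g x := by
  obtain ⟨m, _, hm, _⟩ := hy
  obtain ⟨_, n, _, hn⟩ := hw
  exact ⟨m, n, hm.trans hyz, hzw.trans hn⟩

theorem zpow_mem_orbitHull {g : α ≃o α} {x y : α} (hy : y ∈ orbitHull g x) (k : ℤ) :
    (g ^ k) y ∈ orbitHull g x := by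
  obtain ⟨m, n, hm, hn⟩ := hy
  refine ⟨k + m, k + n, ?_, ?_⟩ <;> rw [zpow_add_app] <;> simpa only [OrderIso.le_iff_le]

theorem app_mem_orbitHull {g : α ≃o α} {x y : α} (hy : y ∈ orbitHull g x) :
    g y ∈ orbitHull g x := by
  simpa using zpow_mem_orbitHull hy 1

theorem inv_app_mem_orbitHull {g : α ≃o α} {x y : α} (hy : y ∈ orbitHull g x) :
    g⁻¹ y ∈ orbitHull g x := by
  simpa using zpow_mem_orbitHull hy (-1)

theorem orbitHull_inv (g : α ≃o α) (x : α) : orbitHull g⁻¹ x = orbitHull g x := by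
  ext y
  constructor
  · rintro ⟨m, n, hm, hn⟩
    exact ⟨-m, -n, by simpa using hm, by simpa using hn⟩
  · rintro ⟨m, n, hm, hn⟩
    exact ⟨-m, -n, by simpa using hm, by simpa using hn⟩

theorem mem_orbitHull_conj (f g : α ≃o α) (x y : α) :
    y ∈ orbitHull (f * g * f⁻¹) (f x) ↔ f⁻¹ y ∈ orbitHull g x := by
  simp only [orbitHull, mem_ofPred_eq, conj_zpow, mul_app, inv_app_self, le_inv_iff, inv_le_iff]

theorem zpow_lt_zpow_app {g : α ≃o α} {x : α} (hx : x < g x) {m n : ℤ} (h : m < n) :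
    (g ^ m) x < (g ^ n) x := by
  have hmono : StrictMono fun k : ℤ => (g ^ k) x := by
    refine strictMono_int_of_lt_succ fun k => ?_
    rw [zpow_add_app, zpow_one]
    exact (g ^ k).lt_iff_lt.2 hx
  exact hmono h

theorem exists_zpow_le_lt {g : α ≃o α} {x y : α} (hx : x < g x) (hy : y ∈ orbitHull g x) :
    ∃ k : ℤ, (g ^ k) x ≤ y ∧ y < (g ^ (k + 1)) x := by
  obtain ⟨m, n, hm, hn⟩ := hy
  obtain ⟨k, hk, hmax⟩ := Int.exists_greatest_of_bdd (P := fun k : ℤ => (g ^ k) x ≤ y)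
    ⟨n, fun z hz => by
      by_contra! hlt
      exact absurd (zpow_lt_zpow_app hx hlt) (not_lt.2 (hz.trans hn))⟩ ⟨m, hm⟩
  refine ⟨k, hk, ?_⟩
  by_contra! hlt
  have := hmax _ hlt
  omega

theorem lt_app_of_mem_orbitHull {g : α ≃o α} {x y : α} (hx : x < g x)
    (hy : y ∈ orbitHull g x) : y < g y := by
  obtain ⟨k, hk, hk'⟩ := exists_zpow_le_lt hx hy
  rw [zpow_succ_app] at hk'
  exact hk'.trans_le (g.le_iff_le.2 hk)

theorem app_lt_of_mem_orbitHull {g : α ≃o α} {x y : α} (hx : g x < x)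
    (hy : y ∈ orbitHull g x) : g y < y := by
  rw [← lt_inv_iff] at hx ⊢
  rw [← orbitHull_inv] at hy
  exact lt_app_of_mem_orbitHull hx hy

theorem app_ne_of_mem_orbitHull {g : α ≃o α} {x y : α} (hx : g x ≠ x)
    (hy : y ∈ orbitHull g x) : g y ≠ y := by
  rcases lt_or_gt_of_ne hx with h | h
  · exact (app_lt_of_mem_orbitHull h hy).ne
  · exact (lt_app_of_mem_orbitHull h hy).ne'

theorem orbitHull_eq_of_mem {g : α ≃o α} {x y : α} (hx : g x ≠ x) (hy : y ∈ orbitHull g x) :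
    orbitHull g y = orbitHull g x := by
  wlog h : x < g x generalizing g
  · have h' : x < g⁻¹ x := lt_inv_iff g |>.2 (lt_of_le_of_ne (not_lt.1 h) hx)
    rw [← orbitHull_inv g y, ← orbitHull_inv g x]
    exact this h'.ne' (by rwa [orbitHull_inv]) h'
  obtain ⟨k, hk, hk'⟩ := exists_zpow_le_lt h hy
  have key : ∀ u ∈ orbitHull g y, ∀ z, z ∈ orbitHull g u → z ∈ orbitHull g y := by
    rintro u hu z ⟨m, n, hm, hn⟩
    exact mem_orbitHull_of_le_of_le (zpow_mem_orbitHull hu m) (zpow_mem_orbitHull hu n) hm hn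
  have hxy : x ∈ orbitHull g y := by
    refine ⟨-(k + 1), -k, ?_, ?_⟩
    · rw [zpow_neg, inv_le_iff]
      exact hk'.le
    · rw [zpow_neg, le_inv_iff]
      exact hk
  ext z
  constructor
  · rintro ⟨m, n, hm, hn⟩
    exact mem_orbitHull_of_le_of_le (zpow_mem_orbitHull hy m) (zpow_mem_orbitHull hy n) hm hn
  · exact key x hxy z

/-- **Hölder's theorem** for a group of order automorphisms acting on an invariant set in such a
way that every element moves all points of the set in the same direction and every orbit of a
moved point is cofinal and coinitial. -/
theorem comm_of_archimedean_action {Γ : Subgroup (α ≃o α)} {A : Set α}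
    (inv : ∀ g ∈ Γ, ∀ x ∈ A, g x ∈ A)
    (dir : ∀ g ∈ Γ, ∀ x ∈ A, ∀ y ∈ A, x < g x → y < g y)
    (arch : ∀ g ∈ Γ, ∀ x ∈ A, ∀ y ∈ A, x < g x → y ∈ orbitHull g x)
    {a b : α ≃o α} (ha : a ∈ Γ) (hb : b ∈ Γ) {x : α} (hx : x ∈ A) : a (b x) = b (a x) := by
  have cmp_lt : ∀ g ∈ Γ, ∀ h ∈ Γ, ∀ x ∈ A, ∀ y ∈ A, g x < h x → g y < h y := by
    intro g hg h hh x hx y hy hlt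
    rw [← lt_inv_iff] at hlt ⊢
    exact dir (g⁻¹ * h) (mul_mem (inv_mem hg) hh) x hx y hy hlt
  have cmp_le : ∀ g ∈ Γ, ∀ h ∈ Γ, ∀ x ∈ A, ∀ y ∈ A, g x ≤ h x → g y ≤ h y := by
    intro g hg h hh x hx y hy hle
    by_contra! hlt
    exact absurd (cmp_lt h hh g hg y hy x hx hlt) (not_lt.2 hle)
  have floor : ∀ e ∈ Γ, x < e x → ∀ g ∈ Γ, ∃ k : ℤ,
      ∀ y ∈ A, (e ^ k) y ≤ g y ∧ g y < (e ^ (k + 1)) y := by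
    intro e he hxe g hg
    obtain ⟨k, hk, hk'⟩ := exists_zpow_le_lt hxe (arch e he x hx (g x) (inv g hg x hx) hxe)
    exact ⟨k, fun y hy => ⟨cmp_le _ (zpow_mem he k) _ hg x hx y hy hk,
      cmp_lt _ hg _ (zpow_mem he _) x hx y hy hk'⟩⟩
  by_contra hne
  wlog hlt : b (a x) < a (b x) generalizing a b
  · exact this hb ha (fun h => hne h.symm) (lt_of_le_of_ne (not_lt.1 hlt) hne)
  obtain ⟨c, hc, hcx⟩ : ∃ c ∈ Γ, ∀ y, c (b (a y)) = a (b y) :=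
    ⟨a * b * (b * a)⁻¹, mul_mem (mul_mem ha hb) (inv_mem (mul_mem hb ha)), fun y => by
      rw [mul_app, ← mul_app b a, inv_app_self, mul_app]⟩
  have hbax : b (a x) ∈ A := inv b hb _ (inv a ha x hx)
  have hxc : x < c x := dir c hc (b (a x)) hbax x hx (by rwa [hcx])
  by_cases hsmall : ∃ e ∈ Γ, x < e x ∧ e (e x) ≤ c x
  · obtain ⟨e, he, hxe, hee⟩ := hsmall
    obtain ⟨m, hm⟩ := floor e he hxe a ha
    obtain ⟨n, hn⟩ := floor e he hxe b hb
    have h1 : a (b x) < (e ^ (m + 1)) ((e ^ (n + 1)) x) :=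
      (hm _ (inv b hb x hx)).2.trans ((e ^ (m + 1)).lt_iff_lt.2 (hn x hx).2)
    have h2 : (e ^ n) ((e ^ m) x) ≤ b (a x) :=
      ((e ^ n).le_iff_le.2 (hm x hx).1).trans (hn _ (inv a ha x hx)).1
    have h3 : (e ^ (m + 1)) ((e ^ (n + 1)) x) = e (e ((e ^ n) ((e ^ m) x))) := by
      rw [← zpow_add_app, ← zpow_add_app, ← zpow_succ_app, ← zpow_succ_app]
      congr 2
      ring
    have h4 : e (e (b (a x))) ≤ c (b (a x)) :=
      cmp_le (e * e) (mul_mem he he) c hc x hx _ hbax hee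
    rw [h3] at h1
    rw [hcx] at h4
    exact absurd (h1.trans_le ((e.le_iff_le.2 (e.le_iff_le.2 h2)).trans h4)) (lt_irrefl _)
  · push Not at hsmall
    have hmin : ∀ e ∈ Γ, x < e x → c x ≤ e x := by
      intro e he hxe
      by_contra! hec
      have h1 : c x < e (e x) := hsmall e he hxe
      have h2 : x < (e⁻¹ * c) x := (lt_inv_iff e).2 hec
      have h3 : (e⁻¹ * c) x < e x := (inv_lt_iff e).2 h1
      have hmem : e⁻¹ * c ∈ Γ := mul_mem (inv_mem he) hc
      have h4 := cmp_lt _ hmem _ he x hx _ (inv _ hmem x hx) h3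
      have h5 : e ((e⁻¹ * c) x) = c x := app_inv_self e _
      rw [h5] at h4
      exact absurd (hsmall _ hmem h2) (not_lt.2 h4.le)
    have hpow : ∀ g ∈ Γ, ∃ k : ℤ, ∀ y ∈ A, g y = (c ^ k) y := by
      intro g hg
      obtain ⟨k, hk⟩ := floor c hc hxc g hg
      have hck : c ^ k ∈ Γ := zpow_mem hc k
      have hle : g x ≤ (c ^ k) x := by
        by_contra! hlt'
        have h1 := hmin ((c ^ k)⁻¹ * g) (mul_mem (inv_mem hck) hg) ((lt_inv_iff _).2 hlt')
        have h2 : (c ^ k) (c x) ≤ g x := (le_inv_iff _).1 h1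
        have h3 := (hk x hx).2
        rw [zpow_add_app, zpow_one] at h3
        exact absurd h3 (not_lt.2 h2)
      exact ⟨k, fun y hy => le_antisymm (cmp_le g hg _ hck x hx y hy hle) (hk y hy).1⟩
    obtain ⟨m, hm⟩ := hpow a ha
    obtain ⟨n, hn⟩ := hpow b hb
    rw [hm _ (inv b hb x hx), hn x hx, hn _ (inv a ha x hx), hm x hx, ← zpow_add_app,
      ← zpow_add_app, add_comm] at hne
    exact hne rfl

end Orbit

section Complete

variable {α : Type*} [CompleteLinearOrder α]

theorem app_eq_of_isGLB {f : α ≃o α} {S : Set α} {a : α} (ha : IsGLB S a)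
    (h : ∀ x ∈ S, f x ∈ S) (h' : ∀ x ∈ S, f⁻¹ x ∈ S) : f a = a := by
  apply le_antisymm
  · refine ha.2 fun x hx => ?_
    rw [← le_inv_iff]
    exact ha.1 (h' x hx)
  · rw [← inv_le_iff]
    refine ha.2 fun x hx => ?_
    rw [inv_le_iff]
    exact ha.1 (h x hx)

theorem app_eq_of_isLUB {f : α ≃o α} {S : Set α} {b : α} (hb : IsLUB S b)
    (h : ∀ x ∈ S, f x ∈ S) (h' : ∀ x ∈ S, f⁻¹ x ∈ S) : f b = b := by
  apply le_antisymm
  · rw [← le_inv_iff]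
    refine hb.2 fun x hx => ?_
    rw [le_inv_iff]
    exact hb.1 (h x hx)
  · refine hb.2 fun x hx => ?_
    rw [← inv_le_iff]
    exact hb.1 (h' x hx)

theorem exists_orbitHull_eq_Ioo {g : α ≃o α} {x : α} (hx : g x ≠ x) :
    ∃ a b, g a = a ∧ g b = b ∧ orbitHull g x = Ioo a b := by
  have hglb := isGLB_sInf (orbitHull g x)
  have hlub := isLUB_sSup (orbitHull g x)
  have ha := app_eq_of_isGLB hglb (fun y hy => app_mem_orbitHull hy)
    fun y hy => inv_app_mem_orbitHull hy
  have hb := app_eq_of_isLUB hlub (fun y hy => app_mem_orbitHull hy)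
    fun y hy => inv_app_mem_orbitHull hy
  refine ⟨_, _, ha, hb, Set.ext fun y => ⟨fun hy => ⟨?_, ?_⟩, fun hy => ?_⟩⟩
  · refine lt_of_le_of_ne (hglb.1 hy) fun h => ?_
    exact app_ne_of_mem_orbitHull hx hy (by rw [← h, ha])
  · refine lt_of_le_of_ne (hlub.1 hy) fun h => ?_
    exact app_ne_of_mem_orbitHull hx hy (by rw [h, hb])
  · obtain ⟨u, hu, huy⟩ := sInf_lt_iff.1 hy.1
    obtain ⟨v, hv, hyv⟩ := lt_sSup_iff.1 hy.2
    exact mem_orbitHull_of_le_of_le hu hv huy.le hyv.le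

/-- Two nested orbit hulls of points moved by elements of `Γ` coincide. -/
def NestedOrbitsEq (Γ : Subgroup (α ≃o α)) : Prop :=
  ∀ f ∈ Γ, ∀ g ∈ Γ, ∀ x y, f x ≠ x → g y ≠ y → orbitHull f x ⊆ orbitHull g y →
    orbitHull f x = orbitHull g y

theorem NestedOrbitsEq.not_crossing {Γ : Subgroup (α ≃o α)} (N : NestedOrbitsEq Γ)
    {f g : α ≃o α} (hf : f ∈ Γ) (hg : g ∈ Γ) {x y a b c d : α} (hx : x < f x) (hy : y < g y)
    (ha : f a = a) (hb : f b = b) (hc : g c = c) (hd : g d = d)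
    (hA : orbitHull f x = Ioo a b) (hB : orbitHull g y = Ioo c d)
    (hac : a < c) (hcb : c < b) (hbd : b < d) : False := by
  have fA : ∀ z, a < z → z < b → z < f z := fun z h1 h2 =>
    lt_app_of_mem_orbitHull hx (hA ▸ ⟨h1, h2⟩)
  have gB : ∀ z, c < z → z < d → z < g z := fun z h1 h2 =>
    lt_app_of_mem_orbitHull hy (hB ▸ ⟨h1, h2⟩)
  have fd : d < f d := by
    by_contra! hle
    have hfy : (f * g * f⁻¹) (f y) ≠ f y := by
      simp only [mul_app, inv_app_self]
      exact fun h => hy.ne' (f.injective h)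
    have hsub : orbitHull (f * g * f⁻¹) (f y) ⊆ orbitHull g y := by
      intro z hz
      rw [mem_orbitHull_conj, hB, mem_Ioo, lt_inv_iff, inv_lt_iff] at hz
      rw [hB]
      exact ⟨(fA c hac hcb).trans hz.1, hz.2.trans_le hle⟩
    have heq := N _ (mul_mem (mul_mem hf hg) (inv_mem hf)) _ hg _ _ hfy hy.ne' hsub
    have hfc : f c ∈ orbitHull g y := by
      rw [hB]
      exact ⟨fA c hac hcb, lt_trans (by rw [← hb]; exact f.lt_iff_lt.2 hcb) hbd⟩
    rw [← heq, mem_orbitHull_conj, inv_app_self, hB] at hfc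
    exact lt_irrefl _ hfc.1
  have ga : a < g a := by
    by_contra! hle
    have hgx : (g * f * g⁻¹) (g x) ≠ g x := by
      simp only [mul_app, inv_app_self]
      exact fun h => hx.ne' (g.injective h)
    have hsub : orbitHull f x ⊆ orbitHull (g * f * g⁻¹) (g x) := by
      intro z hz
      rw [hA] at hz
      rw [mem_orbitHull_conj, hA, mem_Ioo, lt_inv_iff, inv_lt_iff]
      exact ⟨hle.trans_lt hz.1, hz.2.trans (gB b hcb hbd)⟩
    have heq := N _ hf _ (mul_mem (mul_mem hg hf) (inv_mem hg)) _ _ hx.ne' hgx hsub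
    have hmem : b ∈ orbitHull (g * f * g⁻¹) (g x) := by
      rw [mem_orbitHull_conj, hA, mem_Ioo, lt_inv_iff, inv_lt_iff]
      exact ⟨hle.trans_lt (hac.trans hcb), gB b hcb hbd⟩
    rw [← heq, hA] at hmem
    exact lt_irrefl _ hmem.2
  have gle : ∀ z, a ≤ z → z ≤ d → z ≤ g z := by
    intro z haz hzd
    by_contra! hlt
    have hzc : z < c := by
      by_contra! hcz
      rcases hcz.eq_or_lt with rfl | hcz
      · exact hlt.ne hc
      rcases hzd.eq_or_lt with rfl | hzd
      · exact hlt.ne hd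
      exact lt_asymm hlt (gB z hcz hzd)
    obtain ⟨p, q, -, -, hO⟩ := exists_orbitHull_eq_Ioo hlt.ne
    have hsub : ∀ w ∈ orbitHull g z, a < w ∧ w < c := by
      intro w hw
      constructor
      · by_contra! hwa
        exact lt_asymm ga (app_lt_of_mem_orbitHull hlt
          (mem_orbitHull_of_le_of_le hw (self_mem_orbitHull g z) hwa haz))
      · by_contra! hcw
        exact (app_lt_of_mem_orbitHull hlt
          (mem_orbitHull_of_le_of_le (self_mem_orbitHull g z) hw hzc.le hcw)).ne hc
    have heq := N _ hg _ hf _ _ hlt.ne hx.ne' fun w hw => by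
      rw [hA]
      exact ⟨(hsub w hw).1, (hsub w hw).2.trans hcb⟩
    exact lt_irrefl _ (hsub c (by rw [heq, hA]; exact ⟨hac, hcb⟩)).2
  have fle : ∀ z, a ≤ z → z ≤ d → z ≤ f z := by
    intro z haz hzd
    by_contra! hlt
    have hbz : b < z := by
      by_contra! hzb
      rcases hzb.eq_or_lt with rfl | hzb
      · exact hlt.ne hb
      rcases haz.eq_or_lt with rfl | haz
      · exact hlt.ne ha
      exact lt_asymm hlt (fA z haz hzb)
    have hsub : ∀ w ∈ orbitHull f z, b < w ∧ w < d := by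
      intro w hw
      constructor
      · by_contra! hwb
        exact (app_lt_of_mem_orbitHull hlt
          (mem_orbitHull_of_le_of_le hw (self_mem_orbitHull f z) hwb hbz.le)).ne hb
      · by_contra! hdw
        exact lt_asymm fd (app_lt_of_mem_orbitHull hlt
          (mem_orbitHull_of_le_of_le (self_mem_orbitHull f z) hw hzd hdw))
    have heq := N _ hf _ hg _ _ hlt.ne hy.ne' fun w hw => by
      rw [hB]
      exact ⟨hcb.trans (hsub w hw).1, (hsub w hw).2⟩
    exact lt_irrefl _ (hsub b (by rw [heq, hB]; exact ⟨hcb, hbd⟩)).1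
  have had : a < d := hac.trans (hcb.trans hbd)
  have hmove : ∀ z, a ≤ z → z ≤ d → z < (g * f) z := by
    intro z haz hzd
    rw [mul_app]
    rcases haz.eq_or_lt with rfl | haz'
    · rwa [ha]
    rcases lt_or_ge z b with hzb | hbz
    · have h1 : f z < b := by
        rw [← hb]
        exact f.lt_iff_lt.2 hzb
      have h2 := fA z haz' hzb
      exact h2.trans_le (gle _ (haz.trans h2.le) (h1.trans hbd).le)
    rcases hzd.eq_or_lt with rfl | hzd'
    · conv_lhs => rw [← hd]
      exact g.lt_iff_lt.2 fd
    · exact (gB z (hcb.trans_le hbz) hzd').trans_le (g.le_iff_le.2 (fle z haz hzd))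
  have haa := hmove a le_rfl had.le
  obtain ⟨p, q, -, hq, hO⟩ := exists_orbitHull_eq_Ioo haa.ne'
  have hself := self_mem_orbitHull (g * f) a
  rw [hO] at hself
  have hdq : d < q := by
    by_contra! hqd
    exact (hmove q hself.2.le hqd).ne' hq
  have heq := N _ hf _ (mul_mem hg hf) _ _ hx.ne' haa.ne' fun w hw => by
    rw [hA] at hw
    rw [hO]
    exact ⟨hself.1.trans hw.1, hw.2.trans (hbd.trans hdq)⟩
  have hmem := self_mem_orbitHull (g * f) a
  rw [← heq, hA] at hmem
  exact lt_irrefl _ hmem.1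

theorem NestedOrbitsEq.orbitHull_eq {Γ : Subgroup (α ≃o α)} (N : NestedOrbitsEq Γ)
    {f g : α ≃o α} (hf : f ∈ Γ) (hg : g ∈ Γ) {x : α} (hfx : f x ≠ x) (hgx : g x ≠ x) :
    orbitHull f x = orbitHull g x := by
  wlog hfx' : x < f x generalizing f
  · have h := (lt_inv_iff f).2 (lt_of_le_of_ne (not_lt.1 hfx') hfx)
    rw [← orbitHull_inv f]
    exact this (inv_mem hf) h.ne' h
  wlog hgx' : x < g x generalizing g
  · have h := (lt_inv_iff g).2 (lt_of_le_of_ne (not_lt.1 hgx') hgx)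
    rw [← orbitHull_inv g]
    exact this (inv_mem hg) h.ne' h
  obtain ⟨a, b, ha, hb, hA⟩ := exists_orbitHull_eq_Ioo hfx
  obtain ⟨c, d, hc, hd, hB⟩ := exists_orbitHull_eq_Ioo hgx
  have hxA := self_mem_orbitHull f x
  have hxB := self_mem_orbitHull g x
  rw [hA] at hxA
  rw [hB] at hxB
  rcases lt_or_ge a c with hac | hca
  · rcases lt_or_ge b d with hbd | hdb
    · exact (N.not_crossing hf hg hfx' hgx' ha hb hc hd hA hB hac (hxB.1.trans hxA.2) hbd).elim
    · exact (N _ hg _ hf _ _ hgx hfx (hA ▸ hB ▸ Ioo_subset_Ioo hac.le hdb)).symm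
  · rcases lt_or_ge d b with hdb | hbd
    · rcases hca.eq_or_lt with rfl | hca
      · exact (N _ hg _ hf _ _ hgx hfx (hA ▸ hB ▸ Ioo_subset_Ioo le_rfl hdb.le)).symm
      · exact (N.not_crossing hg hf hgx' hfx' hc hd ha hb hB hA hca (hxA.1.trans hxB.2) hdb).elim
    · exact N _ hf _ hg _ _ hfx hgx (hA ▸ hB ▸ Ioo_subset_Ioo hca hbd)

theorem NestedOrbitsEq.apply_comm_of_ne {Γ : Subgroup (α ≃o α)} (N : NestedOrbitsEq Γ)
    {a b f : α ≃o α} (ha : a ∈ Γ) (hb : b ∈ Γ) (hf : f ∈ Γ) {x : α} (hx : f x ≠ x) :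
    a (b x) = b (a x) := by
  have key : ∀ g ∈ Γ, ∀ y ∈ orbitHull f x, g y ≠ y → orbitHull g y = orbitHull f x := by
    intro g hg y hy hgy
    rw [N.orbitHull_eq hg hf hgy (app_ne_of_mem_orbitHull hx hy), orbitHull_eq_of_mem hx hy]
  have keymem : ∀ g ∈ Γ, ∀ y ∈ orbitHull f x, ∀ z ∈ orbitHull f x, y < g y →
      z ∈ orbitHull g y := fun g hg y hy z hz hlt => by rwa [key g hg y hy hlt.ne']
  refine comm_of_archimedean_action (A := orbitHull f x) (fun g hg y hy => ?_)
    (fun g hg y hy z hz hlt => lt_app_of_mem_orbitHull hlt (keymem g hg y hy z hz hlt))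
    keymem ha hb (self_mem_orbitHull f x)
  by_cases hgy : g y = y
  · rwa [hgy]
  · rw [← key g hg y hy hgy]
    exact app_mem_orbitHull (self_mem_orbitHull g y)

theorem NestedOrbitsEq.mul_comm {Γ : Subgroup (α ≃o α)} (N : NestedOrbitsEq Γ)
    {a b : α ≃o α} (ha : a ∈ Γ) (hb : b ∈ Γ) : a * b = b * a := by
  refine OrderIso.ext (funext fun x => ?_)
  rw [mul_app, mul_app]
  by_cases hax : a x = x
  · by_cases hbx : b x = x
    · rw [hax, hbx, hax]
    · exact N.apply_comm_of_ne ha hb hb hbx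
  · exact N.apply_comm_of_ne ha hb ha hax

end Complete

theorem isOrbitalOf_orbitHull {g : HomeoI} {x : unitInterval} (hx : g x ≠ x) :
    IsOrbitalOf g (orbitHull g x) := by
  refine ⟨x, ?_, x, self_mem_orbitHull g x, g x, app_mem_orbitHull (self_mem_orbitHull g x),
    hx.symm⟩
  ext y
  simp [orbitHull, ordHull]

theorem nestedOrbitsEq_of_height_le_one {Γ : Subgroup HomeoI} (h : height Γ ≤ 1) :
    NestedOrbitsEq Γ := by
  intro f hf g hg x y hx hy hsub
  by_contra hne
  have hT : IsTower Γ {(orbitHull f x, f), (orbitHull g y, g)} := by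
    refine ⟨?_, ?_, ?_⟩
    · rintro p (rfl | rfl)
      · exact ⟨hf, isOrbitalOf_orbitHull hx⟩
      · exact ⟨hg, isOrbitalOf_orbitHull hy⟩
    · rintro p (rfl | rfl) q (rfl | rfl)
      · exact Or.inl subset_rfl
      · exact Or.inl hsub
      · exact Or.inr hsub
      · exact Or.inl subset_rfl
    · rintro p (rfl | rfl) q (rfl | rfl) hpq
      · rfl
      · exact (hne hpq).elim
      · exact (hne hpq.symm).elim
      · rfl
  have hle : (towerOrbitals {(orbitHull f x, f), (orbitHull g y, g)}).encard ≤ 1 :=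
    (le_iSup₂_of_le _ hT le_rfl : _ ≤ height Γ).trans h
  rw [towerOrbitals, image_pair, encard_pair hne] at hle
  exact absurd hle (by norm_num)

/-- Every subgroup `Γ ≤ Homeo₊(I)` with `h(Γ) = 1` is Abelian. -/
theorem abelian_of_height_eq_one (Γ : Subgroup HomeoI)
    (h : height Γ = 1) :
    ∀ a ∈ Γ, ∀ b ∈ Γ, a * b = b * a := by
  intro a ha b hb
  exact (nestedOrbitsEq_of_height_le_one h.le).mul_comm ha hb

end HeightHomeo
end

section
/- Let Γ be a nontrivial countable group admitting a left-invariant linear order <. Then Γ admits a faithful action on ℝ by orientation-preserving homeomorphisms without a global fixed point, such that whenever g₁, g₂ ∈ Γ with g₁ < g₂, one has g₁(0) < g₂(0). -/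
open Set

namespace HeightHomeo

/-- The extension to the real line of an order automorphism of the rationals. -/
noncomputable def ratExtend (f : ℚ ≃o ℚ) (x : ℝ) : ℝ :=
  sSup ((fun q : ℚ => ((f q : ℚ) : ℝ)) '' {q : ℚ | (q : ℝ) < x})

theorem lt_ratExtend_iff (f : ℚ ≃o ℚ) (x : ℝ) (r : ℚ) :
    (r : ℝ) < ratExtend f x ↔ ((f.symm r : ℚ) : ℝ) < x := by
  have hne : ((fun q : ℚ => ((f q : ℚ) : ℝ)) '' {q : ℚ | (q : ℝ) < x}).Nonempty := by
    obtain ⟨q, hq⟩ := exists_rat_lt x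
    exact ⟨_, q, hq, rfl⟩
  have hbdd : BddAbove ((fun q : ℚ => ((f q : ℚ) : ℝ)) '' {q : ℚ | (q : ℝ) < x}) := by
    obtain ⟨s, hs⟩ := exists_rat_gt x
    refine ⟨((f s : ℚ) : ℝ), ?_⟩
    rintro _ ⟨q, hq, rfl⟩
    have hqs : q < s := by exact_mod_cast lt_trans (show (q : ℝ) < x from hq) hs
    exact Rat.cast_le.2 (f.monotone hqs.le)
  constructor
  · intro h
    obtain ⟨_, ⟨q, hq, rfl⟩, hr⟩ := exists_lt_of_lt_csSup hne h
    have hrq : r < f q := Rat.cast_lt.1 hr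
    have hq' : f.symm r < q := (f.symm_apply_lt).2 hrq
    exact lt_trans (by exact_mod_cast hq') hq
  · intro h
    obtain ⟨q, hrq, hqx⟩ := exists_rat_btwn h
    have hrq' : r < f q := (f.symm_apply_lt).1 (by exact_mod_cast hrq)
    exact lt_of_lt_of_le (Rat.cast_lt.2 hrq') (le_csSup hbdd ⟨q, hqx, rfl⟩)

theorem ratExtend_monotone (f : ℚ ≃o ℚ) : Monotone (ratExtend f) := fun x y hxy =>
  le_of_forall_rat_lt_imp_le fun r hr =>
    ((lt_ratExtend_iff f y r).2 (((lt_ratExtend_iff f x r).1 hr).trans_le hxy)).le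

theorem ratExtend_trans (f g : ℚ ≃o ℚ) (x : ℝ) :
    ratExtend (g.trans f) x = ratExtend f (ratExtend g x) :=
  eq_of_forall_rat_lt_iff_lt fun r => by
    simp only [lt_ratExtend_iff]
    rfl

theorem ratExtend_refl (x : ℝ) : ratExtend (OrderIso.refl ℚ) x = x :=
  eq_of_forall_rat_lt_iff_lt fun r => lt_ratExtend_iff _ x r

theorem ratExtend_ratCast (f : ℚ ≃o ℚ) (q : ℚ) : ratExtend f q = (f q : ℚ) :=
  eq_of_forall_rat_lt_iff_lt fun r => by
    rw [lt_ratExtend_iff, Rat.cast_lt, Rat.cast_lt, f.symm_apply_lt]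

/-- `ratExtend f` as an order automorphism of the real line. -/
noncomputable def ratExtendIso (f : ℚ ≃o ℚ) : ℝ ≃o ℝ :=
  Equiv.toOrderIso
    { toFun := ratExtend f
      invFun := ratExtend f.symm
      left_inv := fun x => by
        rw [← ratExtend_trans, f.self_trans_symm, ratExtend_refl]
      right_inv := fun x => by
        rw [← ratExtend_trans, f.symm_trans_self, ratExtend_refl] }
    (ratExtend_monotone f) (ratExtend_monotone f.symm)

/-- Order automorphisms of the rationals extend to the real line, compatibly with
composition. -/
noncomputable def ratExtendHom : (ℚ ≃o ℚ) →* (ℝ ≃o ℝ) where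
  toFun := ratExtendIso
  map_one' := OrderIso.ext (funext ratExtend_refl)
  map_mul' f g := OrderIso.ext (funext (ratExtend_trans f g))

theorem ratExtendHom_ratCast (f : ℚ ≃o ℚ) (q : ℚ) :
    ratExtendHom f (q : ℝ) = (f q : ℚ) :=
  ratExtend_ratCast f q

section LexAction

variable {Γ : Type*} [LinearOrder Γ]

theorem denselyOrdered_lex_rat : DenselyOrdered (Γ ×ₗ ℚ) where
  dense a b hab := by
    rcases Prod.Lex.lt_iff.1 hab with h | ⟨h₁, h₂⟩
    · exact ⟨toLex ((ofLex a).1, (ofLex a).2 + 1),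
        Prod.Lex.lt_iff.2 (Or.inr ⟨rfl, lt_add_one _⟩), Prod.Lex.lt_iff.2 (Or.inl h)⟩
    · obtain ⟨c, hc₁, hc₂⟩ := exists_between h₂
      exact ⟨toLex ((ofLex a).1, c), Prod.Lex.lt_iff.2 (Or.inr ⟨rfl, hc₁⟩),
        Prod.Lex.lt_iff.2 (Or.inr ⟨h₁, hc₂⟩)⟩

theorem noMaxOrder_lex_rat : NoMaxOrder (Γ ×ₗ ℚ) where
  exists_gt a := ⟨toLex ((ofLex a).1, (ofLex a).2 + 1),
    Prod.Lex.lt_iff.2 (Or.inr ⟨rfl, lt_add_one _⟩)⟩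

theorem noMinOrder_lex_rat : NoMinOrder (Γ ×ₗ ℚ) where
  exists_lt a := ⟨toLex ((ofLex a).1, (ofLex a).2 - 1),
    Prod.Lex.lt_iff.2 (Or.inr ⟨rfl, sub_one_lt _⟩)⟩

/-- An order isomorphism of `Γ ×ₗ ℚ` with `ℚ` sending a given point to `0`. -/
theorem exists_lex_rat_orderIso [Countable Γ] [Nonempty Γ] (a : Γ ×ₗ ℚ) :
    ∃ e : (Γ ×ₗ ℚ) ≃o ℚ, e a = 0 := by
  have := denselyOrdered_lex_rat (Γ := Γ)
  have := noMaxOrder_lex_rat (Γ := Γ)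
  have := noMinOrder_lex_rat (Γ := Γ)
  have : Countable (Γ ×ₗ ℚ) := inferInstanceAs (Countable (Γ × ℚ))
  have : Nonempty (Γ ×ₗ ℚ) := ⟨a⟩
  obtain ⟨e⟩ := Order.iso_of_countable_dense (Γ ×ₗ ℚ) ℚ
  exact ⟨e.trans (OrderIso.addRight (-(e a))), add_neg_cancel (e a)⟩

variable [Group Γ]

theorem lex_mul_monotone (hleft : ∀ h g₁ g₂ : Γ, g₁ < g₂ → h * g₁ < h * g₂) (g : Γ) :
    Monotone fun p : Γ ×ₗ ℚ => (toLex (g * (ofLex p).1, (ofLex p).2) : Γ ×ₗ ℚ) := by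
  intro p q hpq
  rcases Prod.Lex.le_iff.1 hpq with h | ⟨h₁, h₂⟩
  · exact Prod.Lex.le_iff.2 (Or.inl (hleft g _ _ h))
  · exact Prod.Lex.le_iff.2 (Or.inr ⟨congrArg (g * ·) h₁, h₂⟩)

/-- Left translation by `g` on the first coordinate of `Γ ×ₗ ℚ`. -/
def lexMulIso (hleft : ∀ h g₁ g₂ : Γ, g₁ < g₂ → h * g₁ < h * g₂) (g : Γ) :
    (Γ ×ₗ ℚ) ≃o (Γ ×ₗ ℚ) :=
  Equiv.toOrderIso
    { toFun := fun p => toLex (g * (ofLex p).1, (ofLex p).2)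
      invFun := fun p => toLex (g⁻¹ * (ofLex p).1, (ofLex p).2)
      left_inv := fun p => by simp
      right_inv := fun p => by simp }
    (lex_mul_monotone hleft g) (lex_mul_monotone hleft g⁻¹)

theorem lexMulIso_apply (hleft : ∀ h g₁ g₂ : Γ, g₁ < g₂ → h * g₁ < h * g₂) (g : Γ)
    (p : Γ ×ₗ ℚ) : lexMulIso hleft g p = toLex (g * (ofLex p).1, (ofLex p).2) :=
  rfl

/-- The action of `Γ` on `ℚ` obtained by transporting left translation on `Γ ×ₗ ℚ`. -/
def ratActionHom (hleft : ∀ h g₁ g₂ : Γ, g₁ < g₂ → h * g₁ < h * g₂)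
    (e : (Γ ×ₗ ℚ) ≃o ℚ) : Γ →* (ℚ ≃o ℚ) where
  toFun g := (e.symm.trans (lexMulIso hleft g)).trans e
  map_one' := OrderIso.ext (funext fun q => by
    change e (lexMulIso hleft 1 (e.symm q)) = q
    simp [lexMulIso_apply])
  map_mul' g h := OrderIso.ext (funext fun q => by
    change e (lexMulIso hleft (g * h) (e.symm q)) =
      e (lexMulIso hleft g (e.symm (e (lexMulIso hleft h (e.symm q)))))
    simp [lexMulIso_apply, mul_assoc])

theorem ratActionHom_apply (hleft : ∀ h g₁ g₂ : Γ, g₁ < g₂ → h * g₁ < h * g₂)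
    (e : (Γ ×ₗ ℚ) ≃o ℚ) (g : Γ) (q : ℚ) :
    ratActionHom hleft e g q = e (lexMulIso hleft g (e.symm q)) :=
  rfl

theorem exists_gt_and_exists_lt_of_left_invariant [Nontrivial Γ]
    (hleft : ∀ h g₁ g₂ : Γ, g₁ < g₂ → h * g₁ < h * g₂) (g : Γ) :
    (∃ h, g < h) ∧ ∃ h, h < g := by
  obtain ⟨a, b, hab⟩ := exists_pair_lt Γ
  constructor
  · exact ⟨g * a⁻¹ * b, by simpa using hleft (g * a⁻¹) a b hab⟩
  · exact ⟨g * b⁻¹ * a, by simpa using hleft (g * b⁻¹) a b hab⟩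

end LexAction

/-- Every nontrivial countable group with a left-invariant linear order admits a
faithful action on `ℝ` by orientation-preserving homeomorphisms without a global
fixed point, such that `g₁ < g₂` implies `g₁(0) < g₂(0)`. -/
theorem dynamical_realization (Γ : Type*) [Group Γ] [Countable Γ] [Nontrivial Γ]
    [LinearOrder Γ] (hleft : ∀ h g₁ g₂ : Γ, g₁ < g₂ → h * g₁ < h * g₂) :
    ∃ ρ : Γ →* (ℝ ≃o ℝ), Function.Injective ρ ∧
      (¬ ∃ x : ℝ, ∀ g : Γ, ρ g x = x) ∧
      ∀ g₁ g₂ : Γ, g₁ < g₂ → ρ g₁ 0 < ρ g₂ 0 := by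
  obtain ⟨e, he⟩ := exists_lex_rat_orderIso (toLex ((1 : Γ), (0 : ℚ)))
  let ρ : Γ →* (ℝ ≃o ℝ) := ratExtendHom.comp (ratActionHom hleft e)
  have hρ : ∀ g : Γ, ρ g 0 = (e (toLex (g, 0)) : ℚ) := fun g => by
    have h := ratExtendHom_ratCast (ratActionHom hleft e g) 0
    rw [Rat.cast_zero, ratActionHom_apply, ← he, e.symm_apply_apply, lexMulIso_apply] at h
    simpa [ρ] using h
  have hmono : ∀ g₁ g₂ : Γ, g₁ < g₂ → ρ g₁ 0 < ρ g₂ 0 := fun g₁ g₂ h => by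
    rw [hρ, hρ, Rat.cast_lt, e.lt_iff_lt]
    exact Prod.Lex.lt_iff.2 (Or.inl h)
  refine ⟨ρ, fun g₁ g₂ h => ?_, ?_, hmono⟩
  · exact (show StrictMono fun g => ρ g 0 from fun a b => hmono a b).injective
      (congrArg (fun f : ℝ ≃o ℝ => f 0) h)
  · rintro ⟨x, hx⟩
    rcases le_total 0 x with h0 | h0
    · obtain ⟨q, hq⟩ := exists_rat_gt x
      obtain ⟨g, hg⟩ := (exists_gt_and_exists_lt_of_left_invariant hleft (ofLex (e.symm q)).1).1
      have hlt : e.symm q < toLex (g, 0) := Prod.Lex.lt_iff.2 (Or.inl hg)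
      have hqg : (q : ℝ) < ρ g 0 := by
        rw [hρ, Rat.cast_lt]
        exact e.symm_apply_lt.1 hlt
      have := (ρ g).monotone h0
      rw [hx g] at this
      linarith
    · obtain ⟨q, hq⟩ := exists_rat_lt x
      obtain ⟨g, hg⟩ := (exists_gt_and_exists_lt_of_left_invariant hleft (ofLex (e.symm q)).1).2
      have hlt : toLex (g, 0) < e.symm q := Prod.Lex.lt_iff.2 (Or.inl hg)
      have hqg : ρ g 0 < (q : ℝ) := by
        rw [hρ, Rat.cast_lt]
        exact e.lt_symm_apply.1 hlt
      have := (ρ g).monotone h0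
      rw [hx g] at this
      linarith

end HeightHomeo
end
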